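/- arXiv:1906.03409 — 4 statements merged into one kernel-verified Lean document; each statement's English description precedes it below -/
import Mathlib

section
/- Let {S(t)}_{t≥0} be a twin semigroup on a norming dual pair (Y,Y⋄) with constants M ≥ 1, ω ∈ ℝ and Laplace transform S̄(λ) for λ > ω. Then the subspace of strong continuity X := {y ∈ Y : ‖S(t)y − y‖ → 0 as t ↓ 0} is equal to the norm closure in Y of the domain D(C) of the generator, D(C) = {y ∈ Y : ∃ z ∈ Y, ∃ λ > ω, y = S̄(λ)(λ·y − z)}. -/
open MeasureTheory Filter Topology

/-- A norming dual pair of real Banach spaces: a bounded bilinear pairing such that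
each space norms the other. -/
structure NormingDualPair (Y Yd : Type*) [NormedAddCommGroup Y] [NormedSpace ℝ Y]
    [CompleteSpace Y] [NormedAddCommGroup Yd] [NormedSpace ℝ Yd] [CompleteSpace Yd] where
  pair : Yd →ₗ[ℝ] Y →ₗ[ℝ] ℝ
  M : ℝ
  one_le_M : 1 ≤ M
  pair_bound : ∀ (yd : Yd) (y : Y), |pair yd y| ≤ M * ‖yd‖ * ‖y‖
  norm_eq : ∀ y : Y, ‖y‖ = sSup {r : ℝ | ∃ yd : Yd, ‖yd‖ ≤ 1 ∧ r = |pair yd y|}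
  norm_eq' : ∀ yd : Yd, ‖yd‖ = sSup {r : ℝ | ∃ y : Y, ‖y‖ ≤ 1 ∧ r = |pair yd y|}

/-- A twin semigroup on a norming dual pair `(Y, Yd)`: a semigroup of twin operators,
exponentially bounded, with weakly measurable orbits, whose Laplace transform (for
`λ > omega`) is again a twin operator. -/
structure TwinSemigroup (Y Yd : Type*) [NormedAddCommGroup Y] [NormedSpace ℝ Y]
    [CompleteSpace Y] [NormedAddCommGroup Yd] [NormedSpace ℝ Yd] [CompleteSpace Yd]
    (P : NormingDualPair Y Yd) where
  /-- the action of `S(t)` on `Y` -/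
  S : ℝ → Y →ₗ[ℝ] Y
  /-- the action of `S(t)` on `Yd` -/
  Sd : ℝ → Yd →ₗ[ℝ] Yd
  compat : ∀ t : ℝ, 0 ≤ t → ∀ (yd : Yd) (y : Y), P.pair (Sd t yd) y = P.pair yd (S t y)
  S_zero : S 0 = LinearMap.id
  S_add : ∀ t s : ℝ, 0 ≤ t → 0 ≤ s → ∀ y : Y, S (t + s) y = S t (S s y)
  M : ℝ
  omega : ℝ
  one_le_M : 1 ≤ M
  bound : ∀ t : ℝ, 0 ≤ t → ∀ (yd : Yd) (y : Y),
    |P.pair yd (S t y)| ≤ M * Real.exp (omega * t) * ‖y‖ * ‖yd‖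
  meas : ∀ (yd : Yd) (y : Y), Measurable fun t : ℝ => P.pair yd (S t y)
  /-- the action of the Laplace transform `S̄(λ)` on `Y` -/
  lap : ℝ → Y →ₗ[ℝ] Y
  /-- the action of the Laplace transform `S̄(λ)` on `Yd` -/
  lapd : ℝ → Yd →ₗ[ℝ] Yd
  lap_compat : ∀ l : ℝ, omega < l → ∀ (yd : Yd) (y : Y),
    P.pair (lapd l yd) y = P.pair yd (lap l y)
  lap_eq : ∀ l : ℝ, omega < l → ∀ (yd : Yd) (y : Y),
    P.pair yd (lap l y) = ∫ t in Set.Ioi (0:ℝ), Real.exp (-l * t) * P.pair yd (S t y)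

section helpers
variable {Y Yd : Type*} [NormedAddCommGroup Y] [NormedSpace ℝ Y] [CompleteSpace Y]
    [NormedAddCommGroup Yd] [NormedSpace ℝ Yd] [CompleteSpace Yd]

theorem ndp_norm_le (P : NormingDualPair Y Yd) (y : Y) (C : ℝ) (hC : 0 ≤ C)
    (h : ∀ yd : Yd, ‖yd‖ ≤ 1 → |P.pair yd y| ≤ C) : ‖y‖ ≤ C := by
  rw [P.norm_eq]
  apply Real.sSup_le _ hC
  rintro r ⟨yd, hyd, rfl⟩
  exact h yd hyd

theorem ndp_pair_le (P : NormingDualPair Y Yd) (y : Y) (yd : Yd) (h : ‖yd‖ ≤ 1) :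
    |P.pair yd y| ≤ ‖y‖ := by
  rw [P.norm_eq y]
  apply le_csSup
  · refine ⟨P.M * ‖y‖, ?_⟩
    rintro r ⟨yd, hyd, rfl⟩
    refine (P.pair_bound yd y).trans ?_
    have := P.one_le_M
    have h1 : P.M * ‖yd‖ ≤ P.M * 1 := by gcongr
    rw [mul_one] at h1
    gcongr
  · exact ⟨yd, h, rfl⟩

variable {P : NormingDualPair Y Yd} (T : TwinSemigroup Y Yd P)

theorem twin_pair_le (t : ℝ) (ht : 0 ≤ t) (y : Y) (yd : Yd) (h : ‖yd‖ ≤ 1) :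
    |P.pair yd (T.S t y)| ≤ T.M * Real.exp (T.omega * t) * ‖y‖ := by
  refine (T.bound t ht yd y).trans ?_
  have := T.one_le_M
  exact mul_le_of_le_one_right (by positivity) h

theorem twin_norm_le (t : ℝ) (ht : 0 ≤ t) (y : Y) :
    ‖T.S t y‖ ≤ T.M * Real.exp (T.omega * t) * ‖y‖ := by
  have := T.one_le_M
  exact ndp_norm_le P _ _ (by positivity) (fun yd h => twin_pair_le T t ht y yd h)

theorem exp_int (r : ℝ) (hr : 0 < r) :
    IntegrableOn (fun t : ℝ => Real.exp (-r * t)) (Set.Ioi 0) ∧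
      ∫ t in Set.Ioi (0:ℝ), Real.exp (-r * t) = 1 / r := by
  refine ⟨integrableOn_exp_mul_Ioi (by linarith) 0, ?_⟩
  rw [integral_exp_mul_Ioi (by linarith) 0]
  simp

theorem twin_integrand_le (l : ℝ) (t : ℝ) (ht : 0 ≤ t) (y : Y) (yd : Yd) (h : ‖yd‖ ≤ 1) :
    ‖Real.exp (-l * t) * P.pair yd (T.S t y)‖
      ≤ T.M * ‖y‖ * Real.exp (-(l - T.omega) * t) := by
  rw [norm_mul, Real.norm_eq_abs, Real.norm_eq_abs, abs_of_pos (Real.exp_pos _)]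
  calc _ ≤ Real.exp (-l * t) * (T.M * Real.exp (T.omega * t) * ‖y‖) := by
        gcongr; exact twin_pair_le T t ht y yd h
    _ = T.M * ‖y‖ * (Real.exp (-l * t) * Real.exp (T.omega * t)) := by ring
    _ = _ := by rw [← Real.exp_add]; ring_nf

theorem twin_integrable (l : ℝ) (hl : T.omega < l) (y : Y) (yd : Yd) (h : ‖yd‖ ≤ 1) :
    IntegrableOn (fun t : ℝ => Real.exp (-l * t) * P.pair yd (T.S t y)) (Set.Ioi 0) := by
  refine Integrable.mono' (((exp_int (l - T.omega) (by linarith)).1).const_mul (T.M * ‖y‖)) ?_ ?_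
  · have := T.meas yd y
    exact (Measurable.mul (by fun_prop) this).aestronglyMeasurable
  · refine (ae_restrict_iff' measurableSet_Ioi).2 (Eventually.of_forall fun t ht => ?_)
    exact twin_integrand_le T l t (le_of_lt ht) y yd h

theorem twin_shift (l : ℝ) (hl : T.omega < l) (w : Y) (yd : Yd) (hyd : ‖yd‖ ≤ 1)
    (h : ℝ) (hh : 0 < h) :
    P.pair yd (T.S h (T.lap l w)) = Real.exp (l * h) * (P.pair yd (T.lap l w)
      - ∫ t in (0:ℝ)..h, Real.exp (-l * t) * P.pair yd (T.S t w)) := by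
  set f : ℝ → ℝ := fun t => Real.exp (-l * t) * P.pair yd (T.S t w) with hf
  have hfi : IntegrableOn f (Set.Ioi 0) := twin_integrable T l hl w yd hyd
  have e1 : ∫ t in Set.Ioi (0:ℝ), f (t + h) = ∫ t in Set.Ioi h, f t := by
    have := (measurePreserving_add_right (volume : Measure ℝ) h).setIntegral_preimage_emb
      (measurableEmbedding_addRight h) f (Set.Ioi h)
    simpa using this
  have e2 := intervalIntegral.integral_interval_add_Ioi (b := h) hfi
    (hfi.mono_set (Set.Ioi_subset_Ioi hh.le))
  rw [← T.compat h hh.le, T.lap_eq l hl, T.lap_eq l hl, ← e2, add_sub_cancel_left, ← e1,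
    ← integral_const_mul]
  refine setIntegral_congr_fun measurableSet_Ioi fun t ht => ?_
  have ht' : (0:ℝ) ≤ t := le_of_lt ht
  simp only [hf]
  rw [T.compat h hh.le, ← T.S_add h t hh.le ht', ← mul_assoc, ← Real.exp_add, add_comm h t]
  congr 2
  ring

theorem twin_lap_bound (l : ℝ) (hl : T.omega < l) (w : Y) (h : ℝ) (hh : 0 < h) :
    ‖T.S h (T.lap l w) - T.lap l w‖ ≤
      |Real.exp (l * h) - 1| * ‖T.lap l w‖ + Real.exp (l * h) * (T.M * ‖w‖ * h) := by
  have hM := T.one_le_M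
  refine ndp_norm_le P _ _ (by positivity) fun yd hyd => ?_
  rw [map_sub, twin_shift T l hl w yd hyd h hh]
  have hb : ‖∫ t in (0:ℝ)..h, Real.exp (-l * t) * P.pair yd (T.S t w)‖ ≤ T.M * ‖w‖ * |h - 0| := by
    refine intervalIntegral.norm_integral_le_of_norm_le_const fun t ht => ?_
    rw [Set.uIoc_of_le hh.le] at ht
    refine (twin_integrand_le T l t ht.1.le w yd hyd).trans ?_
    refine mul_le_of_le_one_right (by positivity) (Real.exp_le_one_iff.2 ?_)
    nlinarith [ht.1]
  rw [sub_zero, abs_of_pos hh, Real.norm_eq_abs] at hb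
  have hp := ndp_pair_le P (T.lap l w) yd hyd
  set I := ∫ t in (0:ℝ)..h, Real.exp (-l * t) * P.pair yd (T.S t w)
  set p := P.pair yd (T.lap l w)
  calc |Real.exp (l * h) * (p - I) - p| = |(Real.exp (l * h) - 1) * p - Real.exp (l * h) * I| := by
        congr 1; ring
    _ ≤ |(Real.exp (l * h) - 1) * p| + |Real.exp (l * h) * I| := abs_sub _ _
    _ = |Real.exp (l * h) - 1| * |p| + Real.exp (l * h) * |I| := by
        rw [abs_mul, abs_mul, abs_of_pos (Real.exp_pos (l * h))]
    _ ≤ _ := by gcongr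

theorem twin_lap_tendsto (l : ℝ) (hl : T.omega < l) (w : Y) :
    Tendsto (fun t : ℝ => ‖T.S t (T.lap l w) - T.lap l w‖) (𝓝[>] (0:ℝ)) (𝓝 0) := by
  refine squeeze_zero' (Eventually.of_forall fun t => norm_nonneg _)
    (eventually_nhdsWithin_of_forall fun h hh => twin_lap_bound T l hl w h hh) ?_
  have hc : Continuous fun h : ℝ =>
      |Real.exp (l * h) - 1| * ‖T.lap l w‖ + Real.exp (l * h) * (T.M * ‖w‖ * h) := by fun_prop
  have := hc.tendsto 0
  simp only [mul_zero, Real.exp_zero, sub_self, abs_zero, zero_mul, add_zero] at this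
  exact this.mono_left nhdsWithin_le_nhds

theorem twin_approx (y : Y)
    (hy : Tendsto (fun t : ℝ => ‖T.S t y - y‖) (𝓝[>] (0:ℝ)) (𝓝 0)) (ε : ℝ) (hε : 0 < ε) :
    ∃ l : ℝ, T.omega < l ∧ ‖l • T.lap l y - y‖ ≤ 3 * ε := by
  have hM := T.one_le_M
  obtain ⟨δ, hδ, hδy⟩ : ∃ δ > 0, ∀ t, 0 < t → t < δ → ‖T.S t y - y‖ ≤ ε := by
    have h1 := hy.eventually (eventually_le_nhds hε)
    obtain ⟨δ, hδ, h2⟩ := mem_nhdsGT_iff_exists_Ioo_subset.1 h1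
    exact ⟨δ, hδ, fun t h3 h4 => h2 ⟨h3, h4⟩⟩
  set a := |T.omega| with ha
  set C := (T.M + 1) * ‖y‖ with hC
  have hC0 : 0 ≤ C := by positivity
  have ha0 : 0 ≤ a := abs_nonneg _
  obtain ⟨b, hb0, hb⟩ : ∃ b : ℝ, 0 ≤ b ∧ C ≤ ε * Real.exp (b * δ) := by
    refine ⟨C / (ε * δ), by positivity, ?_⟩
    have h1 := Real.add_one_le_exp (C / (ε * δ) * δ)
    have h2 : C / (ε * δ) * δ = C / ε := by field_simp
    rw [h2] at h1 ⊢
    calc C = ε * (C / ε) := by field_simp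
      _ ≤ _ := by gcongr; linarith
  set c := a + b with hc
  have hkey : ∀ t, 0 < t → ‖T.S t y - y‖ ≤ ε + ε * Real.exp (c * t) := by
    intro t ht
    by_cases htδ : t < δ
    · have := hδy t ht htδ
      have : 0 ≤ ε * Real.exp (c * t) := by positivity
      linarith
    · push Not at htδ
      have h1 := twin_norm_le T t ht.le y
      have h2 : Real.exp (T.omega * t) ≤ Real.exp (a * t) := by
        gcongr; exact le_abs_self _
      have h3 : 1 ≤ Real.exp (a * t) := Real.one_le_exp (by positivity)
      have h4 : ‖T.S t y - y‖ ≤ C * Real.exp (a * t) := by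
        calc _ ≤ ‖T.S t y‖ + ‖y‖ := norm_sub_le _ _
          _ ≤ T.M * Real.exp (a * t) * ‖y‖ + Real.exp (a * t) * ‖y‖ := by
            refine add_le_add (h1.trans ?_) (le_mul_of_one_le_left (norm_nonneg _) h3)
            gcongr
          _ = _ := by rw [hC]; ring
      have h5 : Real.exp (b * δ) ≤ Real.exp (b * t) := by gcongr
      calc _ ≤ C * Real.exp (a * t) := h4
        _ ≤ (ε * Real.exp (b * t)) * Real.exp (a * t) := by
          gcongr; exact hb.trans (by gcongr)
        _ = ε * Real.exp (c * t) := by rw [mul_assoc, ← Real.exp_add, hc]; ring_nf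
        _ ≤ _ := by linarith
  set l := 2 * c + 1 with hl
  have hc0 : 0 ≤ c := by positivity
  have hl0 : 0 < l := by linarith
  have hlo : T.omega < l := by
    have := le_abs_self T.omega
    linarith
  refine ⟨l, hlo, ?_⟩
  refine ndp_norm_le P _ _ (by positivity) fun yd hyd => ?_
  obtain ⟨i1, v1⟩ := exp_int l hl0
  obtain ⟨i2, v2⟩ := exp_int (l - c) (by linarith)
  have hI := twin_integrable T l hlo y yd hyd
  have e : P.pair yd (l • T.lap l y - y)
      = ∫ t in Set.Ioi (0:ℝ), l * (Real.exp (-l * t) * P.pair yd (T.S t y)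
          - Real.exp (-l * t) * P.pair yd y) := by
    rw [integral_const_mul, integral_sub hI (i1.mul_const _), integral_mul_const, v1,
      ← T.lap_eq l hlo, map_sub, map_smul, smul_eq_mul]
    field_simp
  rw [e, ← Real.norm_eq_abs]
  have i3 : IntegrableOn (fun t : ℝ => l * ε * Real.exp (-l * t)
      + l * ε * Real.exp (-(l - c) * t)) (Set.Ioi 0) := (i1.const_mul _).add (i2.const_mul _)
  refine (norm_integral_le_of_norm_le i3 ?_).trans ?_
  · refine (ae_restrict_iff' measurableSet_Ioi).2 (Eventually.of_forall fun t ht => ?_)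
    rw [← mul_sub, ← map_sub, norm_mul, norm_mul, Real.norm_eq_abs, Real.norm_eq_abs,
      Real.norm_eq_abs, abs_of_pos hl0, abs_of_pos (Real.exp_pos _)]
    calc _ ≤ l * (Real.exp (-l * t) * (ε + ε * Real.exp (c * t))) := by
          gcongr; exact (ndp_pair_le P _ yd hyd).trans (hkey t ht)
      _ = l * ε * Real.exp (-l * t) + l * ε * (Real.exp (-l * t) * Real.exp (c * t)) := by ring
      _ = _ := by rw [← Real.exp_add]; ring_nf
      _ ≤ _ := le_rfl
  · rw [integral_add (i1.const_mul _) (i2.const_mul _), integral_const_mul, integral_const_mul,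
      v1, v2]
    have h1 : l * ε * (1 / l) = ε := by field_simp
    have h2 : l * ε * (1 / (l - c)) ≤ 2 * ε := by
      rw [mul_one_div, div_le_iff₀ (by linarith)]
      nlinarith
    linarith

end helpers

/-- Theorem 3.1 of Diekmann–Verduyn Lunel: the subspace of strong continuity of a twin
semigroup equals the norm closure of the domain of the generator. -/
theorem twin_strong_continuity_eq_closure_domain
    {Y Yd : Type*} [NormedAddCommGroup Y] [NormedSpace ℝ Y] [CompleteSpace Y]
    [NormedAddCommGroup Yd] [NormedSpace ℝ Yd] [CompleteSpace Yd]
    (P : NormingDualPair Y Yd) (T : TwinSemigroup Y Yd P) :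
    {y : Y | Tendsto (fun t : ℝ => ‖T.S t y - y‖) (𝓝[>] (0:ℝ)) (𝓝 0)}
      = closure {y : Y | ∃ z : Y, ∃ l : ℝ, T.omega < l ∧ y = T.lap l (l • y - z)} := by
  have hM := T.one_le_M
  ext y
  simp only [Set.mem_setOf_eq]
  constructor
  · intro hy
    rw [Metric.mem_closure_iff]
    intro ε hε
    obtain ⟨l, hl, hb⟩ := twin_approx T y hy (ε / 4) (by positivity)
    refine ⟨l • T.lap l y, ⟨l • (l • T.lap l y) - l • y, l, hl, ?_⟩, ?_⟩
    · rw [sub_sub_cancel, map_smul]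
    · rw [dist_comm, dist_eq_norm]
      linarith
  · intro hy
    rw [Metric.tendsto_nhds]
    intro ε hε
    set K := T.M * Real.exp |T.omega| + 2 with hK
    have hK0 : 0 < K := by positivity
    obtain ⟨d, ⟨z, l, hl, hd⟩, hyd⟩ := Metric.mem_closure_iff.1 hy (ε / (2 * K)) (by positivity)
    have ht : Tendsto (fun t : ℝ => ‖T.S t d - d‖) (𝓝[>] (0:ℝ)) (𝓝 0) := by
      rw [hd]; exact twin_lap_tendsto T l hl _
    filter_upwards [ht.eventually (eventually_lt_nhds (show (0:ℝ) < ε / 2 by positivity)),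
      Ioo_mem_nhdsGT (show (0:ℝ) < 1 by norm_num)] with t h1 h2
    rw [Real.dist_eq, sub_zero, abs_norm]
    rw [dist_eq_norm] at hyd
    have h3 := twin_norm_le T t h2.1.le (y - d)
    have h4 : Real.exp (T.omega * t) ≤ Real.exp |T.omega| := by
      gcongr
      have := le_abs_self T.omega
      have := abs_nonneg T.omega
      nlinarith [h2.1, h2.2]
    have h5 : T.M * Real.exp (T.omega * t) * ‖y - d‖ ≤ T.M * Real.exp |T.omega| * ‖y - d‖ := by
      gcongr
    have h6 : T.S t y - y = T.S t (y - d) + (T.S t d - d) - (y - d) := by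
      rw [map_sub]; abel
    have h7 : K * ‖y - d‖ < ε / 2 := by
      rw [lt_div_iff₀ (by positivity)] at hyd
      linarith
    rw [h6]
    have h8 := norm_sub_le (T.S t (y - d) + (T.S t d - d)) (y - d)
    have h9 := norm_add_le (T.S t (y - d)) (T.S t d - d)
    have h10 := norm_nonneg (y - d)
    have h11 : K * ‖y - d‖ = T.M * Real.exp |T.omega| * ‖y - d‖ + 2 * ‖y - d‖ := by
      rw [hK]; ring
    linarith
end

section
/- Let {S(t)}_{t≥0} be a twin semigroup on a norming dual pair (Y,Y⋄). Assume that (Y, σ(Y,Y⋄)) is sequentially complete, i.e. for every sequence (y_m) in Y such that (⟨y⋄, y_m⟩) converges in ℝ for each y⋄ ∈ Y⋄, there exists y ∈ Y with ⟨y⋄, y_m⟩ → ⟨y⋄, y⟩ for all y⋄. Let q ∈ Y and let f : [0,T] → ℝ be bounded and Borel measurable. Then for every t ∈ [0,T] there exists an element u(t) ∈ Y such that ⟨y⋄, u(t)⟩ = ∫₀ᵗ y⋄S(t−τ)q · f(τ) dτ for all y⋄ ∈ Y⋄. -/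
open MeasureTheory Filter Topology

lemma twin_aux_dense {Y Yd : Type*} [NormedAddCommGroup Y] [NormedSpace ℝ Y]
    [NormedAddCommGroup Yd] [NormedSpace ℝ Yd]
    (pair : Yd →ₗ[ℝ] Y →ₗ[ℝ] ℝ)
    (hseq : ∀ ym : ℕ → Y,
      (∀ yd : Yd, ∃ L : ℝ, Tendsto (fun m => pair yd (ym m)) atTop (𝓝 L)) →
      ∃ y : Y, ∀ yd : Yd, Tendsto (fun m => pair yd (ym m)) atTop (𝓝 (pair yd y)))
    (ν : Measure unitInterval) [IsFiniteMeasure ν]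
    (κ : Yd → unitInterval → ℝ) (hκ : ∀ yd, Measurable (κ yd))
    (K : Yd → ℝ) (hK : ∀ yd x, |κ yd x| ≤ K yd)
    (hmono : ∀ n : ℕ, ∃ u : Y, ∀ yd, pair yd u = ∫ x, (x : ℝ) ^ n * κ yd x ∂ν)
    (H : unitInterval → ℝ) (hH : Integrable H ν) :
    ∃ u : Y, ∀ yd, pair yd u = ∫ x, H x * κ yd x ∂ν := by
  have hint : ∀ (G : unitInterval → ℝ), Integrable G ν → ∀ yd,
      Integrable (fun x => G x * κ yd x) ν := by
    intro G hG yd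
    exact hG.mul_bdd (c := K yd) (hκ yd).aestronglyMeasurable
      (Filter.Eventually.of_forall (fun x => by simpa using hK yd x))
  have hℓ : ∀ yd, ∃ ℓ : Lp ℝ 1 ν →L[ℝ] ℝ, ∀ G : Lp ℝ 1 ν, ℓ G = ∫ x, G x * κ yd x ∂ν := by
    intro yd
    let L : Lp ℝ 1 ν →ₗ[ℝ] ℝ :=
      { toFun := fun G => ∫ x, G x * κ yd x ∂ν
        map_add' := by
          intro a b
          rw [← integral_add (hint _ (L1.integrable_coeFn a) yd)
            (hint _ (L1.integrable_coeFn b) yd)]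
          apply integral_congr_ae
          filter_upwards [Lp.coeFn_add a b] with x hx
          simp only [hx, Pi.add_apply]; ring
        map_smul' := by
          intro c a
          simp only [RingHom.id_apply, smul_eq_mul]
          rw [← integral_const_mul]
          apply integral_congr_ae
          filter_upwards [Lp.coeFn_smul c a] with x hx
          simp only [hx, Pi.smul_apply, smul_eq_mul]; ring }
    refine ⟨L.mkContinuous (K yd) ?_, fun G => rfl⟩
    intro G
    change ‖∫ x, G x * κ yd x ∂ν‖ ≤ K yd * ‖G‖
    rw [L1.norm_eq_integral_norm, ← integral_const_mul]
    apply norm_integral_le_of_norm_le ((L1.integrable_coeFn G).norm.const_mul _)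
    refine Filter.Eventually.of_forall (fun x => ?_)
    rw [norm_mul, mul_comm]
    exact mul_le_mul_of_nonneg_right (hK yd x) (norm_nonneg _)
  choose ℓ hℓ using hℓ
  let V : Set (Lp ℝ 1 ν) := {G | ∃ u : Y, ∀ yd, pair yd u = ℓ yd G}
  have hVc : IsClosed V := by
    apply IsSeqClosed.isClosed
    intro Gs G hGs hlim
    choose us hus using hGs
    have hl : ∀ yd, Tendsto (fun m => pair yd (us m)) atTop (𝓝 (ℓ yd G)) := by
      intro yd
      simp only [hus]
      exact ((ℓ yd).continuous.tendsto G).comp hlim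
    obtain ⟨y, hy⟩ := hseq us (fun yd => ⟨_, hl yd⟩)
    exact ⟨y, fun yd => tendsto_nhds_unique (hy yd) (hl yd)⟩
  let ι : C(unitInterval, ℝ) →L[ℝ] Lp ℝ 1 ν := ContinuousMap.toLp 1 ν ℝ
  have hpoly : ∀ p : Polynomial ℝ, ι (p.toContinuousMapOn unitInterval) ∈ V := by
    intro p
    induction p using Polynomial.induction_on' with
    | add p q hp hq =>
      obtain ⟨u, hu⟩ := hp
      obtain ⟨v, hv⟩ := hq
      refine ⟨u + v, fun yd => ?_⟩
      have : (p + q).toContinuousMapOn unitInterval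
          = p.toContinuousMapOn unitInterval + q.toContinuousMapOn unitInterval := by
        ext x; simp
      rw [this, map_add, map_add, map_add, hu, hv]
    | monomial n a =>
      obtain ⟨u, hu⟩ := hmono n
      refine ⟨a • u, fun yd => ?_⟩
      rw [hℓ, map_smul, hu, smul_eq_mul, ← integral_const_mul]
      apply integral_congr_ae
      filter_upwards [ContinuousMap.coeFn_toLp (p := 1) (𝕜 := ℝ) ν
        ((Polynomial.monomial n a).toContinuousMapOn unitInterval)] with x hx
      change _ = (ContinuousMap.toLp 1 ν ℝ _ : Lp ℝ 1 ν) x * _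
      rw [hx]
      simp; ring
  have hcont : ∀ g : C(unitInterval, ℝ), ι g ∈ V := by
    intro g
    have h1 : g ∈ closure ((polynomialFunctions unitInterval : Subalgebra ℝ C(unitInterval, ℝ)) :
        Set C(unitInterval, ℝ)) := by
      have := polynomialFunctions_closure_eq_top 0 1
      rw [← Subalgebra.topologicalClosure_coe]
      erw [this]
      trivial
    have hcl : IsClosed (ι ⁻¹' V) := hVc.preimage ι.continuous
    refine closure_minimal ?_ hcl h1
    rintro _ ⟨p, -, rfl⟩
    exact hpoly p
  have hall : ∀ G : Lp ℝ 1 ν, G ∈ V := by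
    intro G
    have hd : DenseRange ι := ContinuousMap.toLp_denseRange ℝ ν ℝ (by simp)
    refine closure_minimal ?_ hVc (hd G)
    rintro _ ⟨g, rfl⟩
    exact hcont g
  obtain ⟨u, hu⟩ := hall hH.toL1
  refine ⟨u, fun yd => ?_⟩
  rw [hu, hℓ]
  apply integral_congr_ae
  filter_upwards [hH.coeFn_toL1] with x hx
  rw [hx]

lemma twin_aux_half {Y Yd : Type*} [NormedAddCommGroup Y] [NormedSpace ℝ Y]
    [NormedAddCommGroup Yd] [NormedSpace ℝ Yd]
    (pair : Yd →ₗ[ℝ] Y →ₗ[ℝ] ℝ)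
    (hseq : ∀ ym : ℕ → Y,
      (∀ yd : Yd, ∃ L : ℝ, Tendsto (fun m => pair yd (ym m)) atTop (𝓝 L)) →
      ∃ y : Y, ∀ yd : Yd, Tendsto (fun m => pair yd (ym m)) atTop (𝓝 (pair yd y)))
    (k : Yd → ℝ → ℝ) (hk : ∀ yd, Measurable (k yd))
    (K : Yd → ℝ) (hK : ∀ yd x, 0 ≤ x → |k yd x| ≤ K yd)
    (hmono : ∀ n : ℕ, ∃ u : Y, ∀ yd, pair yd u =
      ∫ s in Set.Ioi (0:ℝ), Real.exp (-s) * (Real.exp (-s) ^ n * k yd s))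
    (h : ℝ → ℝ) (hh : Measurable h) (B : ℝ) (hB : ∀ s, |h s| ≤ B) :
    ∃ u : Y, ∀ yd, pair yd u = ∫ s in Set.Ioi (0:ℝ), Real.exp (-s) * (h s * k yd s) := by
  let μ : Measure ℝ := (volume.restrict (Set.Ioi 0)).withDensity
    (fun s => ENNReal.ofReal (Real.exp (-s)))
  have hfin : IsFiniteMeasure μ := by
    apply isFiniteMeasure_withDensity_ofReal
    exact (integrableOn_exp_neg_Ioi 0).2
  let φ : ℝ → unitInterval := fun s => Set.projIcc 0 1 zero_le_one (Real.exp (-s))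
  have hφ : Measurable φ := by
    have : Continuous φ := continuous_projIcc.comp (by fun_prop)
    exact this.measurable
  let ψ : unitInterval → ℝ := fun x => -Real.log x
  have hψ : Measurable ψ := (Real.measurable_log.comp measurable_subtype_coe).neg
  have hφv : ∀ s, 0 < s → (φ s : ℝ) = Real.exp (-s) := by
    intro s hs
    have : Real.exp (-s) ∈ Set.Icc (0:ℝ) 1 := ⟨(Real.exp_pos _).le, by simpa using hs.le⟩
    simp only [φ]
    rw [Set.projIcc_of_mem _ this]
  have hψφ : ∀ s, 0 < s → ψ (φ s) = s := by
    intro s hs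
    simp [ψ, hφv s hs]
  have hψ0 : ∀ x, 0 ≤ ψ x := by
    intro x
    simpa [ψ] using Real.log_nonpos x.2.1 x.2.2
  have key : ∀ (G : unitInterval → ℝ) (g : ℝ → ℝ), Measurable G → (∀ s, 0 < s → G (φ s) = g s) →
      ∫ x, G x ∂(μ.map φ) = ∫ s in Set.Ioi (0:ℝ), Real.exp (-s) * g s := by
    intro G g hG hg
    rw [integral_map hφ.aemeasurable hG.aestronglyMeasurable]
    rw [integral_withDensity_eq_integral_toReal_smul (by fun_prop) (by simp)]
    apply setIntegral_congr_fun measurableSet_Ioi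
    intro s hs
    simp only [smul_eq_mul]
    rw [hg s hs, ENNReal.toReal_ofReal (Real.exp_pos _).le]
  refine Exists.elim (twin_aux_dense pair hseq (μ.map φ) (fun yd x => k yd (ψ x))
    (fun yd => (hk yd).comp hψ) K (fun yd x => hK yd _ (hψ0 x)) ?_ (fun x => h (ψ x)) ?_) ?_
  rotate_left 2
  · intro u hu
    refine ⟨u, fun yd => ?_⟩
    rw [hu]
    refine key _ (fun s => h s * k yd s) ((hh.comp hψ).mul ((hk yd).comp hψ)) ?_
    intro s hs
    simp only [hψφ s hs]
  · intro n
    obtain ⟨u, hu⟩ := hmono n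
    refine ⟨u, fun yd => ?_⟩
    rw [hu]
    refine (key _ (fun s => Real.exp (-s) ^ n * k yd s)
      ((measurable_subtype_coe.pow_const n).mul ((hk yd).comp hψ)) ?_).symm
    intro s hs
    change (φ s : ℝ) ^ n * k yd (ψ (φ s)) = _
    rw [hψφ s hs, hφv s hs]
  · exact Integrable.of_bound (hh.comp hψ).aestronglyMeasurable B
      (Filter.Eventually.of_forall (fun x => hB _))

/-- Lemma 5.1 (Lemma 4.1) of Diekmann–Verduyn Lunel: if `(Y, σ(Y,Y⋄))` is sequentially
complete, then for `q ∈ Y` and a bounded measurable `f : [0,T] → ℝ`, the weak integral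
`∫₀ᵗ S(t−τ)q f(τ) dτ` is represented by an element of `Y`. -/
theorem twin_voc_integral_represented_of_seq_complete
    {Y Yd : Type*} [NormedAddCommGroup Y] [NormedSpace ℝ Y] [CompleteSpace Y]
    [NormedAddCommGroup Yd] [NormedSpace ℝ Yd] [CompleteSpace Yd]
    (P : NormingDualPair Y Yd) (T : TwinSemigroup Y Yd P)
    (hseq : ∀ ym : ℕ → Y,
      (∀ yd : Yd, ∃ L : ℝ, Tendsto (fun m => P.pair yd (ym m)) atTop (𝓝 L)) →
      ∃ y : Y, ∀ yd : Yd, Tendsto (fun m => P.pair yd (ym m)) atTop (𝓝 (P.pair yd y)))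
    (q : Y) (Tmax : ℝ) (f : ℝ → ℝ) (hfm : Measurable f)
    (C : ℝ) (hfb : ∀ τ ∈ Set.Icc (0:ℝ) Tmax, |f τ| ≤ C) :
    ∀ t ∈ Set.Icc (0:ℝ) Tmax, ∃ u : Y, ∀ yd : Yd,
      P.pair yd u = ∫ τ in (0:ℝ)..t, P.pair yd (T.S (t - τ) q) * f τ := by
  intro t ht
  let h : ℝ → ℝ := (Set.Ioc 0 t).indicator (fun s => Real.exp ((T.omega + 1) * s) * f (t - s))
  have hh : Measurable h := by
    apply Measurable.indicator _ measurableSet_Ioc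
    exact (by fun_prop : Measurable fun s : ℝ => Real.exp ((T.omega + 1) * s)).mul
      (hfm.comp (by fun_prop))
  have hC : 0 ≤ C := (abs_nonneg _).trans (hfb t ht)
  refine Exists.elim (twin_aux_half P.pair hseq
    (fun yd s => Real.exp (-T.omega * s) * P.pair yd (T.S s q))
    (fun yd => (by fun_prop : Measurable fun s : ℝ => Real.exp (-T.omega * s)).mul (T.meas yd q))
    (fun yd => T.M * ‖q‖ * ‖yd‖) ?_ ?_ h hh (Real.exp (|T.omega + 1| * t) * C) ?_) ?_
  rotate_left 3
  · intro u hu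
    refine ⟨u, fun yd => ?_⟩
    rw [hu]
    have e1 := intervalIntegral.integral_comp_sub_left (a := 0) (b := t)
      (fun s => P.pair yd (T.S s q) * f (t - s)) t
    simp only [sub_sub_cancel, sub_self, sub_zero] at e1
    rw [e1, intervalIntegral.integral_of_le ht.1]
    have e2 : Set.Ioi (0:ℝ) ∩ Set.Ioc 0 t = Set.Ioc 0 t :=
      Set.inter_eq_right.mpr (fun s hs => hs.1)
    rw [← e2, ← setIntegral_indicator measurableSet_Ioc]
    apply integral_congr_ae
    refine Filter.Eventually.of_forall (fun s => ?_)
    by_cases hs : s ∈ Set.Ioc 0 t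
    · simp only [h, Set.indicator_of_mem hs]
      have : Real.exp (-s) * (Real.exp ((T.omega + 1) * s) * Real.exp (-T.omega * s)) = 1 := by
        rw [← Real.exp_add, ← Real.exp_add, Real.exp_eq_one_iff]; ring
      linear_combination (f (t - s) * P.pair yd (T.S s q)) * this
    · simp [h, Set.indicator_of_notMem hs]
  · intro yd s hs
    have hb := T.bound s hs yd q
    rw [abs_mul, abs_of_pos (Real.exp_pos _)]
    have h1 : Real.exp (-T.omega * s) * Real.exp (T.omega * s) = 1 := by
      rw [← Real.exp_add, Real.exp_eq_one_iff]; ring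
    calc _ ≤ Real.exp (-T.omega * s) * (T.M * Real.exp (T.omega * s) * ‖q‖ * ‖yd‖) :=
          mul_le_mul_of_nonneg_left hb (Real.exp_pos _).le
      _ = _ := by linear_combination (T.M * ‖q‖ * ‖yd‖) * h1
  · intro n
    refine ⟨T.lap (T.omega + 1 + n) q, fun yd => ?_⟩
    rw [T.lap_eq _ (by have : (0:ℝ) ≤ n := n.cast_nonneg
                       linarith)]
    apply integral_congr_ae
    refine Filter.Eventually.of_forall (fun s => ?_)
    have : Real.exp (-(T.omega + 1 + n) * s)
        = Real.exp (-s) * (Real.exp (-s) ^ n * Real.exp (-T.omega * s)) := by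
      rw [← Real.exp_nat_mul, ← Real.exp_add, ← Real.exp_add]; congr 1; ring
    simp only [this]; ring
  · intro s
    by_cases hs : s ∈ Set.Ioc 0 t
    · simp only [h, Set.indicator_of_mem hs]
      rw [abs_mul, abs_of_pos (Real.exp_pos _)]
      have h1 : |f (t - s)| ≤ C := hfb _ ⟨by linarith [hs.2], by linarith [hs.1, ht.2]⟩
      have h2 : (T.omega + 1) * s ≤ |T.omega + 1| * t :=
        (mul_le_mul_of_nonneg_right (le_abs_self _) hs.1.le).trans
          (mul_le_mul_of_nonneg_left hs.2 (abs_nonneg _))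
      exact mul_le_mul (Real.exp_le_exp.mpr h2) h1 (abs_nonneg _) (Real.exp_pos _).le
    · simp only [h, Set.indicator_of_notMem hs, abs_zero]
      positivity
end

section
/- Let ζ : [0,1] → ℝ^{n×n} have entries of bounded variation, right-continuous on (0,1), with ζ(0) = 0, let φ : [-1,0] → ℝⁿ be bounded and Borel measurable, and let x(·;φ) be the unique solution on [0,∞) of the retarded functional differential equation ẋ(t) = ∫_{[0,1]} dζ(σ) x(t−σ) for t ≥ 0 with x(θ) = φ(θ) on [-1,0] (in the integrated sense x = ζ∗x + f with f(t) = φ(0) + ∫₀¹ (ζ(t+σ)−ζ(σ))φ(−σ)dσ). Define the characteristic matrix Δ(λ) = λI − ∫_{[0,1]} e^{−λσ} dζ(σ). Then there exists ω ∈ ℝ such that for every real λ > ω one has det Δ(λ) ≠ 0 and ∫₀^∞ e^{−λt} x(t;φ) dt = Δ(λ)^{-1} [ φ(0) + ∫_{[0,1]} dζ(σ) e^{−λσ} ∫_{−σ}^0 e^{−λτ} φ(τ) dτ ]. -/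
open MeasureTheory Filter Topology


lemma auxA (μ : Measure ℝ) [IsFiniteMeasure μ] (hae : ∀ᵐ σ ∂μ, σ ∈ Set.Icc (0:ℝ) 1)
    (d : ℝ → ℝ) (hdi : Integrable d μ) (T : ℝ) (hT : 1 ≤ T) (v : ℝ → ℝ)
    (hv : IntervalIntegrable v volume 0 T) :
    ∫ s in (0:ℝ)..T, (∫ σ, (Set.Iic s).indicator d σ ∂μ) * v s
      = ∫ σ, d σ * (∫ s in σ..T, v s) ∂μ := by
  rw [intervalIntegral.integral_of_le (by linarith)]
  have hv' : Integrable v (volume.restrict (Set.Ioc 0 T)) :=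
    (intervalIntegrable_iff_integrableOn_Ioc_of_le (by linarith)).1 hv
  have hS : MeasurableSet {p : ℝ × ℝ | p.2 ≤ p.1} := measurableSet_le measurable_snd measurable_fst
  have hint : Integrable (Function.uncurry fun s σ => (Set.Iic s).indicator d σ * v s)
      ((volume.restrict (Set.Ioc 0 T)).prod μ) := by
    have h := (hv'.mul_prod hdi).indicator hS
    refine h.congr (Eventually.of_forall ?_)
    rintro ⟨s, σ⟩
    by_cases hs : σ ≤ s <;> simp [Function.uncurry, Set.indicator, hs, mul_comm]
  simp_rw [← integral_mul_const]
  rw [integral_integral_swap hint]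
  refine integral_congr_ae ?_
  filter_upwards [hae] with σ hσ
  rw [intervalIntegral.integral_of_le (hσ.2.trans hT), ← integral_const_mul]
  have e1 : ∀ s, (Set.Iic s).indicator d σ * v s = (Set.Ici σ).indicator (fun s => d σ * v s) s := by
    intro s
    by_cases hs : σ ≤ s <;> simp [Set.indicator, hs]
  simp_rw [e1]
  rw [setIntegral_indicator measurableSet_Ici]
  have : (Set.Ioc 0 T ∩ Set.Ici σ : Set ℝ) =ᵐ[volume] (Set.Ioc σ T : Set ℝ) := by
    have h1 : (Set.Ioc 0 T ∩ Set.Ioi σ : Set ℝ) = Set.Ioc σ T := by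
      ext s; simp only [Set.mem_inter_iff, Set.mem_Ioc, Set.mem_Ioi]
      constructor
      · rintro ⟨⟨_, h⟩, h'⟩; exact ⟨h', h⟩
      · rintro ⟨h, h'⟩; exact ⟨⟨lt_of_le_of_lt hσ.1 h, h'⟩, h⟩
    rw [← h1]
    exact (ae_eq_refl _).inter Ioi_ae_eq_Ici.symm
  rw [setIntegral_congr_set this]

lemma auxZm (μ : Measure ℝ) [IsFiniteMeasure μ] (d : ℝ → ℝ) (hdm : Measurable d) :
    Measurable fun s : ℝ => ∫ σ, (Set.Iic s).indicator d σ ∂μ := by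
  have hS : MeasurableSet {p : ℝ × ℝ | p.2 ≤ p.1} := measurableSet_le measurable_snd measurable_fst
  have h : StronglyMeasurable ({p : ℝ × ℝ | p.2 ≤ p.1}.indicator fun p => d p.2) :=
    ((hdm.comp measurable_snd).indicator hS).stronglyMeasurable
  have := (h.integral_prod_right' (ν := μ)).measurable
  exact this

lemma auxZb (μ : Measure ℝ) (d : ℝ → ℝ) (hdi : Integrable d μ) (s : ℝ) :
    |∫ σ, (Set.Iic s).indicator d σ ∂μ| ≤ ∫ σ, |d σ| ∂μ := by
  refine (abs_integral_le_integral_abs).trans ?_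
  refine integral_mono_of_nonneg (Eventually.of_forall fun _ => abs_nonneg _) hdi.abs
    (Eventually.of_forall fun σ => ?_)
  by_cases hs : σ ≤ s <;> simp [Set.indicator, hs]

lemma aux_exp_int (y : ℝ → ℝ) (hy : Measurable y) (C a l : ℝ) (hal : a < l)
    (hb : ∀ t, |y t| ≤ C * Real.exp (a * t)) (c : ℝ) :
    IntegrableOn (fun t => Real.exp (-l * t) * y t) (Set.Ioi c) := by
  have h := (exp_neg_integrableOn_Ioi c (sub_pos.2 hal)).const_mul C
  refine h.mono' (by fun_prop) (Eventually.of_forall fun t => ?_)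
  rw [norm_mul, Real.norm_eq_abs, Real.norm_eq_abs, abs_of_pos (Real.exp_pos _)]
  calc _ ≤ Real.exp (-l * t) * (C * Real.exp (a * t)) := by gcongr; exact hb t
    _ = C * Real.exp (-(l - a) * t) := by
      rw [mul_left_comm, ← Real.exp_add]; ring_nf

lemma aux_li (y : ℝ → ℝ) (hy : Measurable y) (C a : ℝ)
    (hb : ∀ t, |y t| ≤ C * Real.exp (a * t)) (p q : ℝ) : IntervalIntegrable y volume p q := by
  have h : IntervalIntegrable (fun t => C * Real.exp (a * t)) volume p q :=
    (by fun_prop : Continuous fun t => C * Real.exp (a * t)).intervalIntegrable _ _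
  exact h.mono_fun' hy.aestronglyMeasurable (Eventually.of_forall hb)

lemma aux_laplace (y : ℝ → ℝ) (hy : Measurable y) (C a l : ℝ) (ha : 0 < a) (hal : a < l)
    (hb : ∀ t, |y t| ≤ C * Real.exp (a * t)) (σ : ℝ) (hσ : 0 ≤ σ) :
    ∫ t in Set.Ioi (0:ℝ), Real.exp (-l * t) * (∫ s in (-σ)..(t - σ), y s)
      = l⁻¹ * (Real.exp (-l * σ) * ((∫ t in Set.Ioi (0:ℝ), Real.exp (-l * t) * y t)
          + ∫ τ in (-σ)..(0:ℝ), Real.exp (-l * τ) * y τ)) := by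
  have hl : 0 < l := ha.trans hal
  have hb' : ∀ t, |y (t - σ)| ≤ (C * Real.exp (-a * σ)) * Real.exp (a * t) := by
    intro t
    refine (hb _).trans (le_of_eq ?_)
    rw [mul_assoc, ← Real.exp_add]; ring_nf
  have h1 := aux_exp_int (fun t => y (t - σ)) (by fun_prop) _ a l hal hb' 0
  have h2 : IntegrableOn (fun t => Real.exp (-l * t)) (Set.Ioi 0) := exp_neg_integrableOn_Ioi 0 hl
  have h3 := integral_posConvolution h1 h2 (ContinuousLinearMap.mul ℝ ℝ)
  have e2 : ∫ t in Set.Ioi (0:ℝ), Real.exp (-l * t) = l⁻¹ := by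
    rw [integral_exp_mul_Ioi (by linarith)]; simp
  have e3 : ∫ t in Set.Ioi (0:ℝ), Real.exp (-l * t) * y (t - σ)
      = Real.exp (-l * σ) * ((∫ t in Set.Ioi (0:ℝ), Real.exp (-l * t) * y t)
          + ∫ τ in (-σ)..(0:ℝ), Real.exp (-l * τ) * y τ) := by
    have i0 := aux_exp_int y hy C a l hal hb
    rw [add_comm, intervalIntegral.integral_interval_add_Ioi (i0 _) (i0 _), ← integral_const_mul]
    have := (measurePreserving_sub_right volume σ).setIntegral_preimage_emb
      (measurableEmbedding_subRight σ)
      (fun t => Real.exp (-l * σ) * (Real.exp (-l * t) * y t)) (Set.Ioi (-σ))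
    rw [← this]
    have hp : (fun t : ℝ => t - σ) ⁻¹' Set.Ioi (-σ) = Set.Ioi 0 := by
      ext t; simp
    rw [hp]
    congr 1; ext t
    rw [← mul_assoc, ← Real.exp_add]; ring_nf
  have e4 : ∀ t, Real.exp (-l * t) * (∫ s in (-σ)..(t - σ), y s)
     = ∫ s in (0:ℝ)..t, (Real.exp (-l * s) * y (s - σ)) * Real.exp (-l * (t - s)) := by
    intro t
    rw [← intervalIntegral.integral_const_mul]
    have := intervalIntegral.integral_comp_sub_right (a := 0) (b := t) (fun s => Real.exp (-l * t) * y s) σ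
    rw [zero_sub] at this
    rw [← this]
    congr 1; ext s
    rw [mul_right_comm, ← Real.exp_add]; ring_nf
  simp_rw [e4]
  simp only [ContinuousLinearMap.mul_apply'] at h3
  rw [h3, e2, e3, mul_comm]

lemma auxQb (y : ℝ → ℝ) (C a : ℝ) (ha : 0 < a)
    (hb : ∀ t, |y t| ≤ C * Real.exp (a * t)) (σ t : ℝ) (hσ : 0 ≤ σ) (ht : 0 ≤ t) :
    |∫ s in (-σ)..(t - σ), y s| ≤ C / a * Real.exp (a * t) := by
  have hC : 0 ≤ C := by
    have := (abs_nonneg _).trans (hb 0)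
    simpa using this
  have h := intervalIntegral.norm_integral_le_of_norm_le (f := y) (a := -σ) (b := t - σ)
    (μ := volume) (g := fun t => C * Real.exp (a * t)) (by linarith)
    (Eventually.of_forall fun t _ => hb t)
    ((by fun_prop : Continuous fun t => C * Real.exp (a * t)).intervalIntegrable _ _)
  rw [Real.norm_eq_abs] at h
  refine h.trans ?_
  rw [intervalIntegral.integral_const_mul, intervalIntegral.integral_comp_mul_left _ ha.ne',
    integral_exp, smul_eq_mul, div_mul_eq_mul_div, mul_div_assoc, inv_mul_eq_div]
  gcongr
  have h1 : Real.exp (a * (t - σ)) ≤ Real.exp (a * t) := by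
    apply Real.exp_le_exp.2; nlinarith
  have := Real.exp_pos (a * -σ)
  linarith

lemma auxB (μ : Measure ℝ) [IsFiniteMeasure μ] (hae : ∀ᵐ σ ∂μ, σ ∈ Set.Icc (0:ℝ) 1)
    (d : ℝ → ℝ) (hdi : Integrable d μ)
    (y : ℝ → ℝ) (hy : Measurable y) (C a l : ℝ) (ha : 0 < a) (hal : a < l)
    (hb : ∀ t, |y t| ≤ C * Real.exp (a * t)) :
    IntegrableOn (fun t => Real.exp (-l * t) * ∫ σ, d σ * (∫ s in (-σ)..(t - σ), y s) ∂μ)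
      (Set.Ioi (0:ℝ)) ∧
    ∫ t in Set.Ioi (0:ℝ), Real.exp (-l * t) * ∫ σ, d σ * (∫ s in (-σ)..(t - σ), y s) ∂μ
      = ∫ σ, d σ * (l⁻¹ * (Real.exp (-l * σ) * ((∫ t in Set.Ioi (0:ℝ), Real.exp (-l * t) * y t)
          + ∫ τ in (-σ)..(0:ℝ), Real.exp (-l * τ) * y τ))) ∂μ := by
  have hP : Continuous fun t => ∫ s in (0:ℝ)..t, y s :=
    intervalIntegral.continuous_primitive (aux_li y hy C a hb) 0
  have hQ : ∀ σ t, ∫ s in (-σ)..(t - σ), y s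
      = (∫ s in (0:ℝ)..(t - σ), y s) - ∫ s in (0:ℝ)..(-σ), y s := fun σ t =>
    (intervalIntegral.integral_interval_sub_left (aux_li y hy C a hb _ _)
      (aux_li y hy C a hb _ _)).symm
  have hQc : Continuous fun p : ℝ × ℝ => ∫ s in (-p.2)..(p.1 - p.2), y s := by
    simp_rw [hQ]
    exact (hP.comp (by fun_prop : Continuous fun p : ℝ × ℝ => p.1 - p.2)).sub
      (hP.comp (by fun_prop : Continuous fun p : ℝ × ℝ => -p.2))
  have hint : Integrable (Function.uncurry fun t σ =>
      Real.exp (-l * t) * (d σ * (∫ s in (-σ)..(t - σ), y s)))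
      ((volume.restrict (Set.Ioi (0:ℝ))).prod μ) := by
    have h1 := ((exp_neg_integrableOn_Ioi 0 (sub_pos.2 hal)).const_mul (C / a)).mul_prod hdi.abs
    refine h1.mono' ?_ ?_
    · have m1 : AEStronglyMeasurable (fun p : ℝ × ℝ => d p.2)
          ((volume.restrict (Set.Ioi (0:ℝ))).prod μ) := hdi.aestronglyMeasurable.comp_snd
      exact (by fun_prop : Continuous fun p : ℝ × ℝ => Real.exp (-l * p.1)).aestronglyMeasurable.mul
        (m1.mul hQc.aestronglyMeasurable)
    · have a1 : ∀ᵐ p ∂((volume.restrict (Set.Ioi (0:ℝ))).prod μ), p.1 ∈ Set.Ioi (0:ℝ) :=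
        Measure.quasiMeasurePreserving_fst.ae (ae_restrict_mem measurableSet_Ioi)
      have a2 : ∀ᵐ p ∂((volume.restrict (Set.Ioi (0:ℝ))).prod μ), p.2 ∈ Set.Icc (0:ℝ) 1 :=
        Measure.quasiMeasurePreserving_snd.ae hae
      filter_upwards [a1, a2] with p h1 h2
      have h3 := auxQb y C a ha hb p.2 p.1 h2.1 (le_of_lt h1)
      simp only [Function.uncurry, norm_mul, Real.norm_eq_abs, Real.abs_exp]
      calc _ ≤ Real.exp (-l * p.1) * (|d p.2| * (C / a * Real.exp (a * p.1))) := by gcongr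
        _ = C / a * (Real.exp (-l * p.1) * Real.exp (a * p.1)) * |d p.2| := by ring
        _ = _ := by rw [← Real.exp_add]; ring_nf
  constructor
  · have := hint.integral_prod_left
    simp only [Function.uncurry, integral_const_mul] at this
    exact this
  · simp_rw [← integral_const_mul (μ := μ)]
    rw [integral_integral_swap hint]
    refine integral_congr_ae ?_
    filter_upwards [hae] with σ hσ
    rw [← aux_laplace y hy C a l ha hal hb σ hσ.1, ← integral_const_mul]
    congr 1; ext t; ring

lemma auxZv (Z v : ℝ → ℝ) (hZ : Measurable Z) (V : ℝ) (hV : ∀ s, |Z s| ≤ V) (p q : ℝ)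
    (hv : IntervalIntegrable v volume p q) :
    IntervalIntegrable (fun s => Z s * v s) volume p q := by
  have h := (hv.norm.const_mul V)
  refine h.mono_fun' (hZ.aestronglyMeasurable.mul hv.def'.aestronglyMeasurable)
    (Eventually.of_forall fun s => ?_)
  simp only [norm_mul, Real.norm_eq_abs]
  gcongr
  exact hV s

/-- combining the two convolution terms -/
lemma auxD (μ : Measure ℝ) [IsFiniteMeasure μ] (hae : ∀ᵐ σ ∂μ, σ ∈ Set.Icc (0:ℝ) 1)
    (d : ℝ → ℝ) (hdm : Measurable d) (hdi : Integrable d μ)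
    (y : ℝ → ℝ) (hy : Measurable y) (C a : ℝ)
    (hb : ∀ t, |y t| ≤ C * Real.exp (a * t)) (Z : ℝ → ℝ)
    (hZ : Z = fun s => ∫ σ, (Set.Iic s).indicator d σ ∂μ) (t : ℝ) (ht : 0 ≤ t) :
    (∫ s in (0:ℝ)..t, Z (t - s) * y s) + ∫ σ in (0:ℝ)..1, (Z (t + σ) - Z σ) * y (-σ)
      = ∫ σ, d σ * (∫ s in (-σ)..(t - σ), y s) ∂μ := by
  have hli := aux_li y hy C a hb
  have hZm : Measurable Z := hZ ▸ auxZm μ d hdm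
  have hZb : ∀ s, |Z s| ≤ ∫ σ, |d σ| ∂μ := by rw [hZ]; exact auxZb μ d hdi
  have hl1 : ∀ c p q, IntervalIntegrable (fun s => y (c - s)) volume p q := by
    intro c p q
    have := (hli (c - p) (c - q)).comp_sub_left c
    simpa using this
  have hl0 : ∀ p q, IntervalIntegrable (fun s => y (- s)) volume p q := by
    intro p q
    simpa using hl1 0 p q
  have s1 : ∫ s in (0:ℝ)..t, Z (t - s) * y s = ∫ s in (0:ℝ)..t, Z s * y (t - s) := by
    have := intervalIntegral.integral_comp_sub_left (a := 0) (b := t) (fun s => Z s * y (t - s)) t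
    simpa using this
  have s2 : ∫ σ in (0:ℝ)..1, (Z (t + σ) - Z σ) * y (-σ)
      = (∫ s in t..(t+1), Z s * y (t - s)) - ∫ σ in (0:ℝ)..1, Z σ * y (-σ) := by
    simp_rw [sub_mul]
    rw [intervalIntegral.integral_sub]
    · have := intervalIntegral.integral_comp_add_left (a := 0) (b := 1) (fun s => Z s * y (t - s)) t
      simp at this
      rw [this]
    · exact auxZv (fun σ => Z (t + σ)) _ (by fun_prop) _ (fun s => hZb _) _ _ (hl0 _ _)
    · exact auxZv _ _ hZm _ hZb _ _ (hl0 _ _)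
  rw [s1, s2, ← add_sub_assoc, intervalIntegral.integral_add_adjacent_intervals
    (auxZv _ _ hZm _ hZb _ _ (hl1 _ _ _)) (auxZv _ _ hZm _ hZb _ _ (hl1 _ _ _))]
  rw [hZ, auxA μ hae d hdi (t+1) (by linarith) _ (hl1 _ _ _),
    auxA μ hae d hdi 1 le_rfl _ (hl0 _ _)]
  have hc : ∀ v : ℝ → ℝ, (∀ p q, IntervalIntegrable v volume p q) → ∀ T, 
      Integrable (fun σ => d σ * ∫ s in σ..T, v s) μ := by
    intro v hv T
    have hP : Continuous fun t => ∫ s in t..T, v s := by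
      simp_rw [fun t => intervalIntegral.integral_symm (f := v) (μ := volume) T t]
      exact (intervalIntegral.continuous_primitive hv T).neg
    obtain ⟨K, hK⟩ := isCompact_Icc.exists_bound_of_continuousOn (hP.continuousOn (s := Set.Icc 0 1))
    refine hdi.mul_bdd (c := K) hP.aestronglyMeasurable ?_
    filter_upwards [hae] with σ hσ using hK σ hσ
  rw [← integral_sub (hc _ (hl1 t) _) (hc _ hl0 _)]
  congr 1; ext σ
  rw [← mul_sub, intervalIntegral.integral_comp_sub_left (fun s => y s),
    intervalIntegral.integral_comp_neg (fun s => y s)]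
  congr 1
  rw [show t - (t + 1) = -1 by ring, intervalIntegral.integral_interval_sub_left (hli _ _) (hli _ _)]

lemma aux_growth {E : Type*} [NormedAddCommGroup E] [NormedSpace ℝ E] (x : ℝ → E)
    (k : ℝ → ℝ → E) (F M : ℝ) (hM : 0 < M)
    (hxb : ∀ T : ℝ, 0 < T → ∃ C : ℝ, ∀ t ∈ Set.Icc (-1:ℝ) T, ‖x t‖ ≤ C)
    (hx : ∀ t, 0 ≤ t → ‖x t‖ ≤ ‖∫ s in (0:ℝ)..t, k t s‖ + F)
    (hk : ∀ t s, 0 ≤ s → s < t → ‖k t s‖ ≤ M * ‖x s‖) (t : ℝ) (ht : 0 ≤ t) :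
    ‖x t‖ ≤ 2 * F * Real.exp (2 * M * t) := by
  obtain ⟨C, hC⟩ := hxb (t + 1) (by linarith)
  have hF : 0 ≤ F := by simpa using (norm_nonneg _).trans (hx 0 le_rfl)
  have hC0 : 0 ≤ C := (norm_nonneg _).trans (hC 0 ⟨by linarith, by linarith⟩)
  set A : Set ℝ := (fun s => ‖x s‖ * Real.exp (-(2 * M * s))) '' Set.Icc 0 t with hA
  have hbdd : BddAbove A := by
    refine ⟨C, ?_⟩
    rintro _ ⟨s, hs, rfl⟩
    have h1 := hC s ⟨by linarith [hs.1], by linarith [hs.2]⟩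
    have h2 : Real.exp (-(2 * M * s)) ≤ 1 := by
      apply Real.exp_le_one_iff.2
      have := mul_nonneg hM.le hs.1
      linarith
    calc ‖x s‖ * Real.exp (-(2 * M * s)) ≤ C * 1 := by gcongr
      _ = C := mul_one C
  have hS : ∀ s ∈ Set.Icc 0 t, ‖x s‖ ≤ sSup A * Real.exp (2 * M * s) := by
    intro s hs
    have := le_csSup hbdd (Set.mem_image_of_mem _ hs)
    simp only [Real.exp_neg] at this
    rwa [← div_eq_mul_inv, div_le_iff₀ (Real.exp_pos _)] at this
  have hS0 : 0 ≤ sSup A := by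
    simpa using (norm_nonneg _).trans (hS 0 ⟨le_rfl, ht⟩)
  have hle : sSup A ≤ sSup A / 2 + F := by
    apply csSup_le ((Set.nonempty_Icc.2 ht).image _)
    rintro _ ⟨s, hs, rfl⟩
    have h1 : ‖∫ u in (0:ℝ)..s, k s u‖ ≤ ∫ u in (0:ℝ)..s, M * (sSup A * Real.exp (2 * M * u)) := by
      refine intervalIntegral.norm_integral_le_of_norm_le hs.1 ?_
        ((by fun_prop : Continuous fun u => M * (sSup A * Real.exp (2 * M * u))).intervalIntegrable _ _)
      filter_upwards [(Set.finite_singleton s).countable.ae_notMem volume] with u hu hu2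
      have : u < s := lt_of_le_of_ne hu2.2 hu
      refine (hk s u hu2.1.le this).trans ?_
      gcongr
      exact hS u ⟨hu2.1.le, hu2.2.trans hs.2⟩
    have h2 : ∫ u in (0:ℝ)..s, M * (sSup A * Real.exp (2 * M * u))
        ≤ sSup A / 2 * Real.exp (2 * M * s) := by
      rw [intervalIntegral.integral_const_mul, intervalIntegral.integral_const_mul,
        intervalIntegral.integral_comp_mul_left _ (by positivity), integral_exp]
      simp only [smul_eq_mul, mul_zero, Real.exp_zero]
      have : M * (sSup A * ((2 * M)⁻¹ * (Real.exp (2 * M * s) - 1)))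
        = sSup A / 2 * (Real.exp (2 * M * s) - 1) := by field_simp
      rw [this]
      gcongr
      linarith
    have h3 := hx s hs.1
    have h4 : (1:ℝ) ≤ Real.exp (2 * M * s) := by
      apply Real.one_le_exp
      have := mul_nonneg hM.le hs.1
      linarith
    simp only [Real.exp_neg]
    rw [← div_eq_mul_inv, div_le_iff₀ (Real.exp_pos _)]
    nlinarith
  refine (hS t ⟨ht, le_rfl⟩).trans ?_
  gcongr
  linarith

/-- Part of the proof of Theorem 4.5 (Theorem 6.5) of Diekmann–Verduyn Lunel: the
Laplace transform of the solution of the RFDE `ẋ(t) = ∫_{[0,1]} dζ(σ) x(t−σ)` with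
initial datum `φ` equals `Δ(λ)⁻¹[φ(0) + ∫_{[0,1]} dζ(σ) e^{−λσ} ∫_{−σ}^0 e^{−λτ}φ(τ)dτ]`
for all real `λ` larger than some `ω`, where `Δ(λ) = λI − ∫_{[0,1]} e^{−λσ} dζ(σ)` is the
characteristic matrix.  The Borel measure `dζ` determined by the NBV function `ζ` is
represented by a base measure `ζb` with matrix density `ζd`. -/
theorem rfde_laplace_transform {n : ℕ}
    (ζ : ℝ → Matrix (Fin n) (Fin n) ℝ)
    (hζbv : ∀ i j, BoundedVariationOn (fun t => ζ t i j) (Set.Icc 0 1))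
    (hζrc : ∀ t ∈ Set.Ioo (0:ℝ) 1, ∀ i j,
      ContinuousWithinAt (fun s => ζ s i j) (Set.Ici t) t)
    (hζzero : ζ 0 = 0)
    (hζone : ∀ τ : ℝ, 1 ≤ τ → ζ τ = ζ 1)
    -- `ζb`, `ζd` represent the matrix-valued Borel measure on `[0,1]` determined by `ζ`
    (ζb : Measure ℝ) [IsFiniteMeasure ζb] (hsupp : ζb ((Set.Icc (0:ℝ) 1)ᶜ) = 0)
    (ζd : ℝ → Fin n → Fin n → ℝ) (hζdm : ∀ i j, Measurable fun σ => ζd σ i j)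
    (hζdi : ∀ i j, Integrable (fun σ => ζd σ i j) ζb)
    (hlink : ∀ a ∈ Set.Ioc (0:ℝ) 1, ∀ i j,
      ζ a i j = ∫ σ in Set.Icc (0:ℝ) a, ζd σ i j ∂ζb)
    (φ : ℝ → Fin n → ℝ) (hφm : Measurable φ)
    (Cφ : ℝ) (hφb : ∀ θ ∈ Set.Icc (-1:ℝ) 0, ‖φ θ‖ ≤ Cφ)
    -- `x` is the solution of the RFDE in the integrated sense `x = ζ∗x + f`
    (x : ℝ → Fin n → ℝ) (hxm : Measurable x)
    (hxb : ∀ T : ℝ, 0 < T → ∃ C : ℝ, ∀ t ∈ Set.Icc (-1:ℝ) T, ‖x t‖ ≤ C)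
    (hxinit : ∀ θ ∈ Set.Icc (-1:ℝ) 0, x θ = φ θ)
    (hxeq : ∀ t : ℝ, 0 ≤ t →
      x t = (∫ s in (0:ℝ)..t, (ζ (t - s)).mulVec (x s))
        + (φ 0 + ∫ σ in (0:ℝ)..1, (ζ (t + σ) - ζ σ).mulVec (φ (-σ)))) :
    ∃ ω : ℝ, ∀ l : ℝ, ω < l →
      Matrix.det ((l • (1 : Matrix (Fin n) (Fin n) ℝ))
          - Matrix.of fun i j => ∫ σ in Set.Icc (0:ℝ) 1, Real.exp (-l * σ) * ζd σ i j ∂ζb) ≠ 0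
      ∧ IntegrableOn (fun t => Real.exp (-l * t) • x t) (Set.Ioi (0:ℝ))
      ∧ (∫ t in Set.Ioi (0:ℝ), Real.exp (-l * t) • x t)
        = Matrix.mulVec
            (((l • (1 : Matrix (Fin n) (Fin n) ℝ))
              - Matrix.of fun i j =>
                  ∫ σ in Set.Icc (0:ℝ) 1, Real.exp (-l * σ) * ζd σ i j ∂ζb)⁻¹)
            (φ 0 + fun i => ∑ k, ∫ σ in Set.Icc (0:ℝ) 1,
              Real.exp (-l * σ) * ζd σ i k
                * (∫ τ in (-σ)..(0:ℝ), Real.exp (-l * τ) * φ τ k) ∂ζb) := by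
  classical
  have hae : ∀ᵐ σ ∂ζb, σ ∈ Set.Icc (0:ℝ) 1 := by
    rw [ae_iff]; exact hsupp
  have hres : ζb.restrict (Set.Icc (0:ℝ) 1) = ζb := Measure.restrict_eq_self_of_ae_mem hae
  rw [hres]
  -- the representing function
  set Z : Fin n → Fin n → ℝ → ℝ := fun i j s => ∫ σ, (Set.Iic s).indicator (fun σ => ζd σ i j) σ ∂ζb
    with hZdef
  have hZm : ∀ i j, Measurable (Z i j) := fun i j => auxZm ζb _ (hζdm i j)
  set W : Fin n → Fin n → ℝ := fun i j => ∫ σ, |ζd σ i j| ∂ζb with hW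
  have hW0 : ∀ i j, 0 ≤ W i j := fun i j => integral_nonneg fun _ => abs_nonneg _
  have hZb : ∀ i j s, |Z i j s| ≤ W i j := fun i j s => auxZb ζb _ (hζdi i j) s
  have hζZ1 : ∀ t, 0 < t → t ≤ 1 → ∀ i j, ζ t i j = Z i j t := by
    intro t ht ht1 i j
    rw [hlink t ⟨ht, ht1⟩, hZdef, ← integral_indicator measurableSet_Icc]
    refine integral_congr_ae ?_
    filter_upwards [hae] with σ hσ
    by_cases h : σ ≤ t <;> simp [Set.indicator, h, hσ.1]
  have hζZ : ∀ t, 0 < t → ∀ i j, ζ t i j = Z i j t := by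
    intro t ht i j
    rcases le_total t 1 with h1 | h1
    · exact hζZ1 t ht h1 i j
    · rw [hζone t h1, hζZ1 1 one_pos le_rfl]
      refine integral_congr_ae ?_
      filter_upwards [hae] with σ hσ
      simp [Set.indicator, hσ.2, hσ.2.trans h1]
  set V : ℝ := ∑ i, ∑ j, W i j with hV
  have hVi : ∀ i, ∑ j, W i j ≤ V := fun i =>
    Finset.single_le_sum (f := fun i => ∑ j, W i j)
      (fun i _ => Finset.sum_nonneg fun j _ => hW0 i j) (Finset.mem_univ i)
  have hV0 : 0 ≤ V := Finset.sum_nonneg fun i _ => Finset.sum_nonneg fun j _ => hW0 i j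
  have hmv : ∀ t, 0 < t → ∀ v : Fin n → ℝ, ‖(ζ t).mulVec v‖ ≤ V * ‖v‖ := by
    intro t ht v
    rw [pi_norm_le_iff_of_nonneg (by positivity)]
    intro i
    rw [Matrix.mulVec, dotProduct, Real.norm_eq_abs]
    refine (Finset.abs_sum_le_sum_abs _ _).trans ?_
    calc _ ≤ ∑ j, W i j * ‖v‖ := by
          refine Finset.sum_le_sum fun j _ => ?_
          rw [abs_mul, hζZ t ht]
          gcongr
          · exact hZb i j t
          · exact norm_le_pi_norm v j
      _ = (∑ j, W i j) * ‖v‖ := by rw [Finset.sum_mul]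
      _ ≤ _ := by gcongr; exact hVi i
  have hCφ : 0 ≤ Cφ := (norm_nonneg _).trans (hφb 0 ⟨by norm_num, le_rfl⟩)
  -- exponential growth
  set F : ℝ := ‖φ 0‖ + 2 * V * Cφ with hF
  have hF0 : 0 ≤ F := by positivity
  set a : ℝ := 2 * (V + 1) with ha_def
  have ha : 0 < a := by positivity
  have hgrow : ∀ t, 0 ≤ t → ‖x t‖ ≤ 2 * F * Real.exp (a * t) := by
    refine aux_growth x (fun t s => (ζ (t - s)).mulVec (x s)) F (V + 1) (by positivity) hxb ?_ ?_
    · intro t ht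
      rw [hxeq t ht]
      refine (norm_add_le _ _).trans ?_
      gcongr
      refine (norm_add_le _ _).trans ?_
      rw [hF]
      gcongr
      refine (intervalIntegral.norm_integral_le_of_norm_le_const (C := 2 * V * Cφ) ?_).trans (by simp)
      intro s hs
      rw [Set.uIoc_of_le zero_le_one] at hs
      have h3 := hφb (-s) ⟨by linarith [hs.2], by linarith [hs.1]⟩
      rw [Matrix.sub_mulVec]
      refine (norm_sub_le _ _).trans ?_
      have h1 := hmv (t + s) (by linarith [hs.1]) (φ (-s))
      have h2 := hmv s hs.1 (φ (-s))
      nlinarith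
    · intro t s hs hst
      refine (hmv (t - s) (by linarith) _).trans ?_
      gcongr
      linarith
  -- extension by zero
  set y : Fin n → ℝ → ℝ := fun k t => if -1 ≤ t then x t k else 0 with hy_def
  have hym : ∀ k, Measurable (y k) := fun k =>
    Measurable.ite measurableSet_Ici ((measurable_pi_apply k).comp hxm) measurable_const
  have hyx : ∀ k t, 0 ≤ t → y k t = x t k := fun k t ht => if_pos (by linarith)
  have hyφ : ∀ k t, t ∈ Set.Icc (-1:ℝ) 0 → y k t = φ t k := fun k t ht => by
    rw [← hxinit t ht]; exact if_pos ht.1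
  set C : ℝ := (2 * F + Cφ) * Real.exp a with hC
  have hyb : ∀ k t, |y k t| ≤ C * Real.exp (a * t) := by
    intro k t
    rcases le_or_gt 0 t with h0 | h0
    · rw [hyx k t h0]
      refine (norm_le_pi_norm (x t) k).trans ((hgrow t h0).trans ?_)
      gcongr
      have : 1 ≤ Real.exp a := Real.one_le_exp ha.le
      rw [hC]
      nlinarith
    · by_cases h1 : -1 ≤ t
      · rw [hyφ k t ⟨h1, h0.le⟩]
        refine (norm_le_pi_norm (φ t) k).trans ((hφb t ⟨h1, h0.le⟩).trans ?_)
        rw [hC, mul_assoc, ← Real.exp_add]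
        have : 1 ≤ Real.exp (a + a * t) := Real.one_le_exp (by nlinarith)
        nlinarith
      · simp only [hy_def, h1, if_false, abs_zero]
        positivity
  have hli := fun k => aux_li (y k) (hym k) C a (hyb k)
  have hlineg : ∀ k p q, IntervalIntegrable (fun s => y k (-s)) volume p q := by
    intro k p q
    have := (hli k (0 - p) (0 - q)).comp_sub_left 0
    simpa using this
  -- componentwise equation
  have hcomp : ∀ t, 0 ≤ t → ∀ i, x t i
      = φ 0 i + ∑ k, ∫ σ, ζd σ i k * (∫ s in (-σ)..(t - σ), y k s) ∂ζb := by
    intro t ht i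
    have e1 : (∫ s in (0:ℝ)..t, (ζ (t - s)).mulVec (x s)) i
        = ∑ k, ∫ s in (0:ℝ)..t, Z i k (t - s) * y k s := by
      have hint : ∀ i k, IntervalIntegrable (fun s => Z i k (t - s) * y k s) volume 0 t :=
        fun i k => auxZv (fun s => Z i k (t - s)) _
          ((hZm i k).comp (by fun_prop)) _ (fun s => hZb i k _) _ _ (hli k _ _)
      have : ∫ s in (0:ℝ)..t, (ζ (t - s)).mulVec (x s)
          = ∫ s in (0:ℝ)..t, fun i => ∑ k, Z i k (t - s) * y k s := by
        refine intervalIntegral.integral_congr_ae ?_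
        filter_upwards [(Set.finite_singleton t).countable.ae_notMem volume] with s hs hs2
        rw [Set.uIoc_of_le ht] at hs2
        have : s < t := lt_of_le_of_ne hs2.2 hs
        ext i
        rw [Matrix.mulVec, dotProduct]
        refine Finset.sum_congr rfl fun k _ => ?_
        rw [hζZ _ (sub_pos.2 this), hyx k s hs2.1.le]
      rw [this, intervalIntegral.integral_of_le ht, eval_integral, integral_finsetSum]
      · simp_rw [intervalIntegral.integral_of_le ht]
      · intro k _
        exact (hint i k).1
      · intro i
        exact integrable_finsetSum _ fun k _ => (hint i k).1
    have e2 : (∫ σ in (0:ℝ)..1, (ζ (t + σ) - ζ σ).mulVec (φ (-σ))) i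
        = ∑ k, ∫ σ in (0:ℝ)..1, (Z i k (t + σ) - Z i k σ) * y k (-σ) := by
      have hint : ∀ i k, IntervalIntegrable
          (fun σ => (Z i k (t + σ) - Z i k σ) * y k (-σ)) volume 0 1 :=
        fun i k => auxZv (fun σ => (Z i k (t + σ) - Z i k σ)) _
          (((hZm i k).comp (by fun_prop)).sub (hZm i k)) (W i k + W i k)
          (fun s => (abs_sub _ _).trans (add_le_add (hZb i k _) (hZb i k _))) _ _ (hlineg k _ _)
      have : ∫ σ in (0:ℝ)..1, (ζ (t + σ) - ζ σ).mulVec (φ (-σ))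
          = ∫ σ in (0:ℝ)..1, fun i => ∑ k, (Z i k (t + σ) - Z i k σ) * y k (-σ) := by
        refine intervalIntegral.integral_congr_ae (Eventually.of_forall fun s hs2 => ?_)
        rw [Set.uIoc_of_le zero_le_one] at hs2
        ext i
        rw [Matrix.mulVec, dotProduct]
        refine Finset.sum_congr rfl fun k _ => ?_
        rw [Matrix.sub_apply, hζZ _ hs2.1, hζZ (t + s) (by linarith [hs2.1]),
          hyφ k (-s) ⟨by linarith [hs2.2], by linarith [hs2.1]⟩]
      rw [this, intervalIntegral.integral_of_le zero_le_one, eval_integral, integral_finsetSum]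
      · simp_rw [intervalIntegral.integral_of_le zero_le_one]
      · intro k _
        exact (hint i k).1
      · intro i
        exact integrable_finsetSum _ fun k _ => (hint i k).1
    rw [hxeq t ht, Pi.add_apply, Pi.add_apply, e1, e2, add_left_comm, ← Finset.sum_add_distrib]
    congr 1
    refine Finset.sum_congr rfl fun k _ => ?_
    exact auxD ζb hae _ (hζdm i k) (hζdi i k) (y k) (hym k) C a (hyb k) (Z i k) rfl t ht
  refine ⟨a, fun l hl => ?_⟩
  have hl0 : 0 < l := ha.trans hl
  set B : Matrix (Fin n) (Fin n) ℝ := Matrix.of fun i j => ∫ σ, Real.exp (-l * σ) * ζd σ i j ∂ζb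
    with hB
  have hexp1 : ∀ᵐ σ ∂ζb, ‖Real.exp (-l * σ)‖ ≤ 1 := by
    filter_upwards [hae] with σ hσ
    rw [Real.norm_eq_abs, Real.abs_exp]
    apply Real.exp_le_one_iff.2
    nlinarith [hσ.1]
  have hdint : ∀ i j, Integrable (fun σ => Real.exp (-l * σ) * ζd σ i j) ζb := fun i j =>
    (hζdi i j).bdd_mul (c := 1) (by fun_prop) hexp1
  have hBW : ∀ i j, |B i j| ≤ W i j := by
    intro i j
    refine (abs_integral_le_integral_abs).trans ?_
    refine integral_mono_ae (hdint i j).abs (hζdi i j).abs ?_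
    filter_upwards [hexp1] with σ hσ
    simp only [abs_mul]
    exact mul_le_of_le_one_left (abs_nonneg _) hσ
  have hdet : Matrix.det (l • (1 : Matrix (Fin n) (Fin n) ℝ) - B) ≠ 0 := by
    apply det_ne_zero_of_sum_row_lt_diag
    intro k
    have h1 : ∑ j ∈ Finset.univ.erase k, ‖(l • (1 : Matrix (Fin n) (Fin n) ℝ) - B) k j‖
        ≤ ∑ j ∈ Finset.univ.erase k, W k j := by
      refine Finset.sum_le_sum fun j hj => ?_
      have : k ≠ j := (Finset.ne_of_mem_erase hj).symm
      simpa [Matrix.one_apply, this] using hBW k j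
    have h2 := Finset.sum_erase_add Finset.univ (fun j => W k j) (Finset.mem_univ k)
    have h3 : l - W k k ≤ ‖(l • (1 : Matrix (Fin n) (Fin n) ℝ) - B) k k‖ := by
      simp only [Matrix.sub_apply, Matrix.smul_apply, Matrix.one_apply_eq, smul_eq_mul, mul_one]
      have := le_abs_self (l - B k k)
      have := (abs_le.1 (hBW k k)).2
      rw [Real.norm_eq_abs]
      linarith
    have := hVi k
    linarith
  have hxc : ∀ k, IntegrableOn (fun t => Real.exp (-l * t) * x t k) (Set.Ioi (0:ℝ)) := fun k =>
    (aux_exp_int (y k) (hym k) C a l hl (hyb k) 0).congr_fun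
      (fun t ht => by simp only [hyx k t (le_of_lt ht)]) measurableSet_Ioi
  have hxi : IntegrableOn (fun t => Real.exp (-l * t) • x t) (Set.Ioi (0:ℝ)) :=
    Integrable.of_eval fun k => hxc k
  refine ⟨hdet, hxi, ?_⟩
  set X : Fin n → ℝ := ∫ t in Set.Ioi (0:ℝ), Real.exp (-l * t) • x t with hX
  have hXk : ∀ k, X k = ∫ t in Set.Ioi (0:ℝ), Real.exp (-l * t) * x t k := fun k => by
    exact eval_integral (f := fun t => Real.exp (-l * t) • x t) (fun k => hxc k) k
  have hXy : ∀ k, ∫ t in Set.Ioi (0:ℝ), Real.exp (-l * t) * y k t = X k := fun k => by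
    rw [hXk]
    exact setIntegral_congr_fun measurableSet_Ioi
      (fun t ht => by simp only [hyx k t (le_of_lt ht)])
  set G : Fin n → ℝ := fun i => ∑ k, ∫ σ, Real.exp (-l * σ) * ζd σ i k
                * (∫ τ in (-σ)..(0:ℝ), Real.exp (-l * τ) * φ τ k) ∂ζb with hG
  have hkey : ∀ i, l * X i = φ 0 i + ∑ k, B i k * X k + G i := by
    intro i
    have hB' := fun k => auxB ζb hae _ (hζdi i k) (y k) (hym k) C a l ha hl (hyb k)
    have e1 : X i = φ 0 i * l⁻¹ + ∑ k, ∫ σ, ζd σ i k * (l⁻¹ * (Real.exp (-l * σ) * (X k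
          + ∫ τ in (-σ)..(0:ℝ), Real.exp (-l * τ) * y k τ))) ∂ζb := by
      have hexpi : IntegrableOn (fun t => Real.exp (-l * t)) (Set.Ioi 0) :=
        exp_neg_integrableOn_Ioi 0 hl0
      have ee : ∫ t in Set.Ioi (0:ℝ), Real.exp (-l * t) = l⁻¹ := by
        rw [integral_exp_mul_Ioi (by linarith)]; simp
      have : X i = ∫ t in Set.Ioi (0:ℝ), (φ 0 i * Real.exp (-l * t) +
          ∑ k, Real.exp (-l * t) * ∫ σ, ζd σ i k * (∫ s in (-σ)..(t - σ), y k s) ∂ζb) := by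
        rw [hXk]
        refine setIntegral_congr_fun measurableSet_Ioi fun t ht => ?_
        simp only [hcomp t (le_of_lt ht) i, mul_add, Finset.mul_sum]
        ring
      rw [this, integral_add (hexpi.const_mul _) (integrable_finsetSum _ fun k _ => (hB' k).1),
        integral_const_mul, ee, integral_finsetSum _ fun k _ => (hB' k).1]
      congr 1
      refine Finset.sum_congr rfl fun k _ => ?_
      rw [(hB' k).2, hXy k]
    have e2 : ∀ k, ∫ σ, ζd σ i k * (l⁻¹ * (Real.exp (-l * σ) * (X k
          + ∫ τ in (-σ)..(0:ℝ), Real.exp (-l * τ) * y k τ))) ∂ζb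
        = l⁻¹ * (B i k * X k + ∫ σ, Real.exp (-l * σ) * ζd σ i k
                * (∫ τ in (-σ)..(0:ℝ), Real.exp (-l * τ) * φ τ k) ∂ζb) := by
      intro k
      have hP : Continuous fun σ : ℝ => ∫ τ in (-σ)..(0:ℝ), Real.exp (-l * τ) * y k τ := by
        have h0 : ∀ p q, IntervalIntegrable (fun τ => Real.exp (-l * τ) * y k τ) volume p q :=
          fun p q => (hli k p q).continuousOn_mul (by fun_prop)
        simp_rw [fun σ : ℝ => intervalIntegral.integral_symm
          (f := fun τ => Real.exp (-l * τ) * y k τ) (μ := volume) 0 (-σ)]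
        exact ((intervalIntegral.continuous_primitive h0 0).comp continuous_neg).neg
      obtain ⟨K, hK⟩ := isCompact_Icc.exists_bound_of_continuousOn
        (hP.continuousOn (s := Set.Icc 0 1))
      have hi : Integrable (fun σ => Real.exp (-l * σ) * ζd σ i k *
          ∫ τ in (-σ)..(0:ℝ), Real.exp (-l * τ) * y k τ) ζb := by
        refine (hdint i k).mul_bdd (c := K) hP.aestronglyMeasurable ?_
        filter_upwards [hae] with σ hσ using hK σ hσ
      have c1 : ∫ σ, Real.exp (-l * σ) * ζd σ i k
                * (∫ τ in (-σ)..(0:ℝ), Real.exp (-l * τ) * φ τ k) ∂ζb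
          = ∫ σ, Real.exp (-l * σ) * ζd σ i k
                * (∫ τ in (-σ)..(0:ℝ), Real.exp (-l * τ) * y k τ) ∂ζb := by
        refine integral_congr_ae ?_
        filter_upwards [hae] with σ hσ
        congr 1
        refine intervalIntegral.integral_congr fun τ hτ => ?_
        rw [Set.uIcc_of_le (by linarith [hσ.1])] at hτ
        simp only [hyφ k τ ⟨by linarith [hσ.2, hτ.1], hτ.2⟩]
      have c2 : B i k * X k = ∫ σ, Real.exp (-l * σ) * ζd σ i k * X k ∂ζb := by
        rw [integral_mul_const]; rfl
      rw [c1, c2, ← integral_add ((hdint i k).mul_const _) hi, ← integral_const_mul]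
      congr 1; ext σ; ring
    rw [e1]
    simp_rw [e2]
    rw [← Finset.mul_sum, Finset.sum_add_distrib]
    have : G i = ∑ k, ∫ σ, Real.exp (-l * σ) * ζd σ i k
                * (∫ τ in (-σ)..(0:ℝ), Real.exp (-l * τ) * φ τ k) ∂ζb := rfl
    rw [← this]
    field_simp
    ring
  have hAX : (l • (1 : Matrix (Fin n) (Fin n) ℝ) - B).mulVec X = φ 0 + G := by
    ext i
    rw [Matrix.sub_mulVec, Matrix.smul_mulVec, Matrix.one_mulVec]
    simp only [Pi.sub_apply, Pi.smul_apply, smul_eq_mul, Pi.add_apply]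
    rw [hkey i, Matrix.mulVec, dotProduct]
    ring
  rw [← hAX, Matrix.mulVec_mulVec, Matrix.nonsing_inv_mul _ (isUnit_iff_ne_zero.2 hdet),
    Matrix.one_mulVec]
end

section
/- Let μ be a ℂ^{n×n}-valued local Borel measure on [0,∞) (countably additive on bounded Borel sets, with finite total variation on every compact interval). Then there exists a ℂ^{n×n}-valued local Borel measure ρ on [0,∞) satisfying the resolvent equations ρ − μ ∗ ρ = μ = ρ − ρ ∗ μ if and only if det[ I − μ({0}) ] ≠ 0; and when such ρ exists it is unique. -/
open MeasureTheory Filter Topology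

/-- A `ℂ^{n×n}`-valued local Borel measure on `[0,∞)`: countably additive on bounded
Borel sets with finite total variation on compacts.  It is represented by a positive
base measure together with a locally integrable matrix-valued density. -/
structure LocalMatrixMeasure (n : ℕ) where
  base : MeasureTheory.Measure ℝ
  dens : ℝ → Fin n → Fin n → ℂ
  meas : ∀ i j, Measurable fun t => dens t i j
  locInt : ∀ T : ℝ, ∀ i j, MeasureTheory.IntegrableOn (fun t => dens t i j) (Set.Icc 0 T) base
  supp : base (Set.Iio 0) = 0

namespace LocalMatrixMeasure

/-- The value `μ(E)` of the matrix measure on a Borel set `E`. -/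
noncomputable def val {n : ℕ} (μ : LocalMatrixMeasure n) (E : Set ℝ) :
    Matrix (Fin n) (Fin n) ℂ :=
  Matrix.of fun i j => ∫ t in E, μ.dens t i j ∂μ.base

/-- The half-line convolution of two matrix measures:
`(μ ∗ ν)(E) = ∫_{[0,∞)} μ(ds) ν((E−s) ∩ [0,∞))`. -/
noncomputable def conv {n : ℕ} (μ ν : LocalMatrixMeasure n) (E : Set ℝ) :
    Matrix (Fin n) (Fin n) ℂ :=
  Matrix.of fun i j => ∑ k, ∫ s in Set.Ici (0:ℝ),
    μ.dens s i k * ν.val ((· + s) ⁻¹' E ∩ Set.Ici 0) k j ∂μ.base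

/-- `ρ` is the resolvent of `μ`: `ρ − μ ∗ ρ = μ = ρ − ρ ∗ μ` (as an identity of local
measures, i.e. on every bounded Borel set). -/
def IsResolvent {n : ℕ} (μ ρ : LocalMatrixMeasure n) : Prop :=
  ∀ E : Set ℝ, MeasurableSet E → Bornology.IsBounded E →
    ρ.val E - μ.conv ρ E = μ.val E ∧ ρ.val E - ρ.conv μ E = μ.val E

end LocalMatrixMeasure

namespace LocalMatrixMeasure

/-- Bounded measurable functions supported in `[0,T]`, with bound `C`. -/
def Dom {n : ℕ} (C T : ℝ) (g : ℝ → Fin n → ℂ) : Prop :=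
  0 ≤ C ∧ Measurable g ∧ ∀ t, ‖g t‖ ≤ (Set.Icc 0 T).indicator (fun _ => C) t

/-- The (anticausal) convolution operator of a matrix measure. -/
noncomputable def op {n : ℕ} (μ : LocalMatrixMeasure n) (g : ℝ → Fin n → ℂ) : ℝ → Fin n → ℂ :=
  fun t i => if 0 ≤ t then ∑ k, ∫ s, μ.dens s i k * g (s + t) k ∂μ.base else 0

/-- Shift and cut. -/
noncomputable def shift {n : ℕ} (a : ℝ) (g : ℝ → Fin n → ℂ) : ℝ → Fin n → ℂ :=
  fun t => if 0 ≤ t then g (t + a) else 0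

/-- Vector indicator. -/
noncomputable def ind {n : ℕ} (E : Set ℝ) (j : Fin n) : ℝ → Fin n → ℂ :=
  E.indicator (fun _ => Pi.single j 1)

/-- Sequentially continuous linear shift-invariant operators. -/
structure IsOp {n : ℕ} (Φ : (ℝ → Fin n → ℂ) → (ℝ → Fin n → ℂ)) : Prop where
  dom : ∀ T : ℝ, ∃ K : ℝ, 0 ≤ K ∧ ∀ C g, Dom C T g → Dom (K * C) T (Φ g)
  add : ∀ C T C' T' g h, Dom C T g → Dom C' T' h → Φ (g + h) = Φ g + Φ h
  smul : ∀ C T g (c : ℂ), Dom C T g → Φ (c • g) = c • Φ g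
  cont : ∀ {ι : Type} (l : Filter ι) [l.IsCountablyGenerated] C T (G : ι → ℝ → Fin n → ℂ) g,
    (∀ m, Dom C T (G m)) → Dom C T g → (∀ t, Tendsto (fun m => G m t) l (𝓝 (g t))) →
    ∀ t, Tendsto (fun m => Φ (G m) t) l (𝓝 (Φ g t))
  shift : ∀ C T g a, Dom C T g → 0 ≤ a → Φ (shift a g) = LocalMatrixMeasure.shift a (Φ g)

variable {n : ℕ}

theorem Dom.zero_of_neg {C T : ℝ} {g : ℝ → Fin n → ℂ} (h : Dom C T g) {t : ℝ} (ht : t < 0) :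
    g t = 0 := by
  have := h.2.2 t
  rw [Set.indicator_of_notMem (by simp [ht])] at this
  simpa using this

theorem Dom.zero_of_gt {C T : ℝ} {g : ℝ → Fin n → ℂ} (h : Dom C T g) {t : ℝ} (ht : T < t) :
    g t = 0 := by
  have := h.2.2 t
  rw [Set.indicator_of_notMem (by simp [ht])] at this
  simpa using this

theorem Dom.le {C T : ℝ} {g : ℝ → Fin n → ℂ} (h : Dom C T g) (t : ℝ) :
    ‖g t‖ ≤ C := by
  have := h.2.2 t
  by_cases ht : t ∈ Set.Icc 0 T
  · rwa [Set.indicator_of_mem ht] at this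
  · rw [Set.indicator_of_notMem ht] at this
    exact this.trans h.1

theorem Dom.mk' {C T : ℝ} {g : ℝ → Fin n → ℂ} (h0 : 0 ≤ C) (hm : Measurable g)
    (h1 : ∀ t < 0, g t = 0) (h2 : ∀ t, T < t → g t = 0) (h3 : ∀ t, ‖g t‖ ≤ C) : Dom C T g := by
  refine ⟨h0, hm, fun t => ?_⟩
  by_cases ht : t ∈ Set.Icc 0 T
  · rw [Set.indicator_of_mem ht]; exact h3 t
  · rw [Set.indicator_of_notMem ht]
    rw [Set.mem_Icc, not_and_or, not_le, not_le] at ht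
    rcases ht with ht | ht
    · rw [h1 t ht]; simp
    · rw [h2 t ht]; simp

theorem Dom.mono {C T C' T' : ℝ} {g : ℝ → Fin n → ℂ} (h : Dom C T g) (hC : C ≤ C') (hT : T ≤ T') :
    Dom C' T' g :=
  Dom.mk' (h.1.trans hC) h.2.1 (fun _ ht => h.zero_of_neg ht)
    (fun _ ht => h.zero_of_gt (hT.trans_lt ht)) (fun t => (h.le t).trans hC)

theorem Dom.add {C T C' T' : ℝ} {g g' : ℝ → Fin n → ℂ} (h : Dom C T g) (h' : Dom C' T' g') :
    Dom (C + C') (max T T') (g + g') := by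
  refine Dom.mk' (add_nonneg h.1 h'.1) (h.2.1.add h'.2.1) ?_ ?_ ?_
  · intro t ht; simp [h.zero_of_neg ht, h'.zero_of_neg ht]
  · intro t ht
    simp [h.zero_of_gt ((le_max_left _ _).trans_lt ht), h'.zero_of_gt ((le_max_right _ _).trans_lt ht)]
  · intro t; exact (norm_add_le _ _).trans (add_le_add (h.le t) (h'.le t))

theorem Dom.smul {C T : ℝ} {g : ℝ → Fin n → ℂ} (h : Dom C T g) (c : ℂ) :
    Dom (‖c‖ * C) T (c • g) := by
  refine Dom.mk' (mul_nonneg (norm_nonneg _) h.1) (h.2.1.const_smul c) ?_ ?_ ?_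
  · intro t ht; simp [h.zero_of_neg ht]
  · intro t ht; simp [h.zero_of_gt ht]
  · intro t
    rw [Pi.smul_apply, norm_smul]
    exact mul_le_mul_of_nonneg_left (h.le t) (norm_nonneg _)

theorem Dom.sub {C T C' T' : ℝ} {g g' : ℝ → Fin n → ℂ} (h : Dom C T g) (h' : Dom C' T' g') :
    Dom (C + C') (max T T') (g - g') := by
  have := h.add (h'.smul (-1))
  simpa [sub_eq_add_neg] using this

theorem Dom.shift {C T : ℝ} {g : ℝ → Fin n → ℂ} (h : Dom C T g) {a : ℝ} (ha : 0 ≤ a) :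
    Dom C T (shift a g) := by
  refine Dom.mk' h.1 ?_ ?_ ?_ ?_
  · unfold LocalMatrixMeasure.shift
    exact Measurable.ite measurableSet_Ici (h.2.1.comp (measurable_id.add_const a)) measurable_const
  · intro t ht; simp [LocalMatrixMeasure.shift, not_le.2 ht]
  · intro t ht
    have := h.zero_of_gt (t := t + a) (by linarith)
    simp [LocalMatrixMeasure.shift, this]
  · intro t
    unfold LocalMatrixMeasure.shift
    split_ifs
    · exact h.le _
    · simpa using h.1

theorem ind_dom {E : Set ℝ} {T : ℝ} (hE : MeasurableSet E) (h : E ⊆ Set.Icc 0 T) (j : Fin n) :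
    Dom 1 T (ind E j) := by
  have hn : ∀ t, t ∉ Set.Icc 0 T → ind E j t = 0 := fun t ht => by
    rw [ind, Set.indicator_of_notMem (fun h' => ht (h h'))]
  refine Dom.mk' zero_le_one (measurable_const.indicator hE) ?_ ?_ ?_
  · intro t ht; exact hn t (by simp [ht])
  · intro t ht; exact hn t (by simp [ht])
  · intro t
    unfold ind
    refine (norm_indicator_le_norm_self _ _).trans ?_
    rw [pi_norm_le_iff_of_nonneg zero_le_one]
    intro i
    by_cases hi : i = j
    · subst hi; simp
    · simp [hi]

/-- Sum of absolute values of the entries of the density. -/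
noncomputable def D (μ : LocalMatrixMeasure n) (s : ℝ) : ℝ := ∑ i, ∑ k, ‖μ.dens s i k‖

theorem D_nonneg (μ : LocalMatrixMeasure n) (s : ℝ) : 0 ≤ μ.D s :=
  Finset.sum_nonneg fun _ _ => Finset.sum_nonneg fun _ _ => norm_nonneg _

theorem row_le_D (μ : LocalMatrixMeasure n) (s : ℝ) (i : Fin n) :
    ∑ k, ‖μ.dens s i k‖ ≤ μ.D s :=
  Finset.single_le_sum (f := fun i => ∑ k, ‖μ.dens s i k‖)
    (fun _ _ => Finset.sum_nonneg fun _ _ => norm_nonneg _) (Finset.mem_univ i)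

theorem D_meas (μ : LocalMatrixMeasure n) : Measurable μ.D := by
  unfold D
  exact Finset.measurable_sum _ fun i _ => Finset.measurable_sum _ fun k _ => (μ.meas i k).norm

theorem D_int (μ : LocalMatrixMeasure n) (T : ℝ) : IntegrableOn μ.D (Set.Icc 0 T) μ.base := by
  unfold D
  exact integrable_finsetSum _ fun i _ => integrable_finsetSum _ fun k _ => (μ.locInt T i k).norm

theorem ae_nonneg (μ : LocalMatrixMeasure n) : ∀ᵐ s ∂μ.base, 0 ≤ s := by
  rw [ae_iff]
  simpa [Set.Iio] using μ.supp

theorem integrable_mul (μ : LocalMatrixMeasure n) {h : ℝ → ℂ} {C T : ℝ} (hm : Measurable h)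
    (hb : ∀ s, 0 ≤ s → ‖h s‖ ≤ (Set.Icc 0 T).indicator (fun _ => C) s) (i k : Fin n) :
    Integrable (fun s => μ.dens s i k * h s) μ.base := by
  have h1 : Integrable ((Set.Icc 0 T).indicator (fun s => ‖μ.dens s i k‖ * C)) μ.base :=
    IntegrableOn.integrable_indicator ((μ.locInt T i k).norm.mul_const C) measurableSet_Icc
  refine h1.mono' ((μ.meas i k).mul hm).aestronglyMeasurable ?_
  filter_upwards [μ.ae_nonneg] with s hs
  have := hb s hs
  rw [norm_mul]
  by_cases hT : s ∈ Set.Icc 0 T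
  · rw [Set.indicator_of_mem hT] at this ⊢
    exact mul_le_mul_of_nonneg_left this (norm_nonneg _)
  · rw [Set.indicator_of_notMem hT] at this ⊢
    have h0 : ‖h s‖ = 0 := le_antisymm this (norm_nonneg _)
    simp [h0]

theorem Dom.shift_bound {C T : ℝ} {g : ℝ → Fin n → ℂ} (h : Dom C T g) {t : ℝ} (ht : 0 ≤ t)
    (k : Fin n) (s : ℝ) (hs : 0 ≤ s) :
    ‖g (s + t) k‖ ≤ (Set.Icc 0 T).indicator (fun _ => C) s := by
  by_cases hT : s ∈ Set.Icc 0 T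
  · rw [Set.indicator_of_mem hT]
    exact (norm_le_pi_norm _ k).trans (h.le _)
  · rw [Set.indicator_of_notMem hT, h.zero_of_gt]
    · simp
    · simp only [Set.mem_Icc, not_and, not_le] at hT
      linarith [hT hs]

theorem Dom.meas_shift {C T : ℝ} {g : ℝ → Fin n → ℂ} (h : Dom C T g) (t : ℝ) (k : Fin n) :
    Measurable (fun s => g (s + t) k) :=
  (measurable_pi_apply k).comp (h.2.1.comp (measurable_id.add_const t))

theorem Dom.integrable {C T : ℝ} {g : ℝ → Fin n → ℂ} (h : Dom C T g) (μ : LocalMatrixMeasure n)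
    {t : ℝ} (ht : 0 ≤ t) (i k : Fin n) :
    Integrable (fun s => μ.dens s i k * g (s + t) k) μ.base :=
  μ.integrable_mul (h.meas_shift t k) (h.shift_bound ht k) i k

theorem op_add (μ : LocalMatrixMeasure n) {C T C' T' : ℝ} {g g' : ℝ → Fin n → ℂ} (h : Dom C T g)
    (h' : Dom C' T' g') : μ.op (g + g') = μ.op g + μ.op g' := by
  ext t i
  by_cases ht : 0 ≤ t
  · simp only [op, ht, if_true, Pi.add_apply, mul_add]
    rw [← Finset.sum_add_distrib]
    exact Finset.sum_congr rfl fun k _ => integral_add (h.integrable μ ht i k) (h'.integrable μ ht i k)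
  · simp [op, ht]

theorem op_smul (μ : LocalMatrixMeasure n) (g : ℝ → Fin n → ℂ) (c : ℂ) :
    μ.op (c • g) = c • μ.op g := by
  ext t i
  by_cases ht : 0 ≤ t
  · simp only [op, ht, if_true, Pi.smul_apply, smul_eq_mul, mul_left_comm _ c, integral_const_mul,
      Finset.mul_sum]
  · simp [op, ht]

theorem op_shift (μ : LocalMatrixMeasure n) (g : ℝ → Fin n → ℂ) {a : ℝ} (ha : 0 ≤ a) :
    μ.op (shift a g) = shift a (μ.op g) := by
  ext t i
  by_cases ht : 0 ≤ t
  · simp only [op, shift, ht, if_true, add_nonneg ht ha]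
    refine Finset.sum_congr rfl fun k _ => integral_congr_ae ?_
    filter_upwards [μ.ae_nonneg] with s hs
    rw [if_pos (add_nonneg hs ht), add_assoc]
  · simp [op, ht, shift]

theorem op_cont (μ : LocalMatrixMeasure n) {ι : Type} (l : Filter ι) [l.IsCountablyGenerated] {C T : ℝ}
    {G : ι → ℝ → Fin n → ℂ} {g : ℝ → Fin n → ℂ}
    (hG : ∀ m, Dom C T (G m)) (hlim : ∀ t, Tendsto (fun m => G m t) l (𝓝 (g t))) (t : ℝ) :
    Tendsto (fun m => μ.op (G m) t) l (𝓝 (μ.op g t)) := by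
  rw [tendsto_pi_nhds]
  intro i
  by_cases ht : 0 ≤ t
  · simp only [op, ht, if_true]
    refine tendsto_finsetSum _ fun k _ => ?_
    refine tendsto_integral_filter_of_dominated_convergence
      ((Set.Icc 0 T).indicator (fun s => ‖μ.dens s i k‖ * C)) ?_ ?_ ?_ ?_
    · exact Eventually.of_forall fun m => ((hG m).integrable μ ht i k).aestronglyMeasurable
    · refine Eventually.of_forall fun m => ?_
      filter_upwards [μ.ae_nonneg] with s hs
      have := (hG m).shift_bound ht k s hs
      rw [norm_mul]
      refine (mul_le_mul_of_nonneg_left this (norm_nonneg _)).trans ?_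
      by_cases hT : s ∈ Set.Icc 0 T <;> simp [hT]
    · exact IntegrableOn.integrable_indicator ((μ.locInt T i k).norm.mul_const C) measurableSet_Icc
    · refine Eventually.of_forall fun s => ?_
      exact (tendsto_pi_nhds.1 (hlim (s + t)) k).const_mul _
  · simpa [op, ht] using tendsto_const_nhds

theorem exists_sfinite (μ : LocalMatrixMeasure n) : ∃ A : Set ℝ, MeasurableSet A ∧
    SFinite (μ.base.restrict A) ∧ ∀ s, 0 ≤ s → s ∉ A → μ.D s = 0 := by
  let B : ℕ → Set ℝ := fun m => {s | 1 / ((m : ℝ) + 1) ≤ ‖μ.D s‖} ∩ Set.Icc 0 (m : ℝ)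
  have hBm : ∀ m, MeasurableSet (B m) := fun m =>
    (measurableSet_le measurable_const μ.D_meas.norm).inter measurableSet_Icc
  have hBf : ∀ m, μ.base (B m) < ⊤ := fun m => by
    have := (μ.D_int m).measure_norm_ge_lt_top (ε := 1 / ((m : ℝ) + 1)) (by positivity)
    rwa [Measure.restrict_apply (measurableSet_le measurable_const μ.D_meas.norm)] at this
  refine ⟨⋃ m, B m, MeasurableSet.iUnion hBm, ?_, ?_⟩
  · rw [← iUnion_disjointed, Measure.restrict_iUnion (disjoint_disjointed B)
      (fun m => MeasurableSet.disjointed hBm m)]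
    have : ∀ m, IsFiniteMeasure (μ.base.restrict (disjointed B m)) := fun m =>
      ⟨by
        rw [Measure.restrict_apply_univ]
        exact (measure_mono (disjointed_subset B m)).trans_lt (hBf m)⟩
    infer_instance
  · intro s hs hsA
    by_contra hD
    apply hsA
    have hpos : 0 < ‖μ.D s‖ := norm_pos_iff.2 hD
    obtain ⟨m1, hm1⟩ := exists_nat_one_div_lt hpos
    obtain ⟨m2, hm2⟩ := exists_nat_ge s
    refine Set.mem_iUnion.2 ⟨max m1 m2, ?_, hs, ?_⟩
    · refine le_trans ?_ hm1.le
      have : (m1 : ℝ) ≤ (max m1 m2 : ℕ) := by exact_mod_cast le_max_left _ _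
      exact one_div_le_one_div_of_le (by positivity) (by linarith)
    · exact hm2.trans (by exact_mod_cast le_max_right _ _)

theorem dens_eq_zero_of_D (μ : LocalMatrixMeasure n) {s : ℝ} (h : μ.D s = 0) (i k : Fin n) :
    μ.dens s i k = 0 := by
  have h1 : ‖μ.dens s i k‖ ≤ 0 := by
    rw [← h]
    refine le_trans ?_ (μ.row_le_D s i)
    exact Finset.single_le_sum (f := fun k => ‖μ.dens s i k‖) (fun _ _ => norm_nonneg _)
      (Finset.mem_univ k)
  simpa using h1

theorem op_meas (μ : LocalMatrixMeasure n) {g : ℝ → Fin n → ℂ} (hg : Measurable g) :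
    Measurable (μ.op g) := by
  obtain ⟨A, hA, hs, hz⟩ := μ.exists_sfinite
  refine measurable_pi_lambda _ fun i => ?_
  unfold op
  refine Measurable.ite measurableSet_Ici ?_ measurable_const
  refine Finset.measurable_sum _ fun k _ => ?_
  have : (fun t => ∫ s, μ.dens s i k * g (s + t) k ∂μ.base) =
      fun t => ∫ s, μ.dens s i k * g (s + t) k ∂(μ.base.restrict A) := by
    funext t
    rw [← integral_indicator hA]
    refine integral_congr_ae ?_
    filter_upwards [μ.ae_nonneg] with s hs0
    by_cases hsA : s ∈ A
    · simp [hsA]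
    · simp [hsA, μ.dens_eq_zero_of_D (hz s hs0 hsA)]
  rw [this]
  refine (StronglyMeasurable.integral_prod_left (μ := μ.base.restrict A)
    (f := fun s t => μ.dens s i k * g (s + t) k) ?_).measurable
  refine Measurable.stronglyMeasurable ?_
  refine ((μ.meas i k).comp measurable_fst).mul ?_
  exact (measurable_pi_apply k).comp (hg.comp (measurable_fst.add measurable_snd))

/-- Weighted bound. -/
theorem op_bound (μ : LocalMatrixMeasure n) {g : ℝ → Fin n → ℂ} {C T ω : ℝ} (hC : 0 ≤ C)
    (hg : ∀ t, 0 ≤ t → ‖g t‖ ≤ (Set.Icc 0 T).indicator (fun t => C * Real.exp (-ω * t)) t) (t : ℝ) :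
    ‖μ.op g t‖ ≤ (Set.Icc 0 T).indicator
      (fun t => (∫ s in Set.Icc 0 T, Real.exp (-ω * s) * μ.D s ∂μ.base) * C * Real.exp (-ω * t)) t := by
  have hI : IntegrableOn (fun s => Real.exp (-ω * s) * μ.D s) (Set.Icc 0 T) μ.base :=
    (μ.D_int T).continuousOn_mul (by fun_prop) isCompact_Icc
  by_cases ht : t ∈ Set.Icc 0 T
  · rw [Set.indicator_of_mem ht]
    have hQ : 0 ≤ ∫ s in Set.Icc 0 T, Real.exp (-ω * s) * μ.D s ∂μ.base :=
      integral_nonneg fun s => mul_nonneg (Real.exp_pos _).le (μ.D_nonneg s)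
    rw [pi_norm_le_iff_of_nonneg (by positivity)]
    intro i
    simp only [op, ht.1, if_true]
    have hIk : ∀ k, Integrable ((Set.Icc 0 T).indicator fun s => ‖μ.dens s i k‖ *
        (C * Real.exp (-ω * (s + t)))) μ.base := fun k =>
      IntegrableOn.integrable_indicator
        (IntegrableOn.mul_continuousOn (μ.locInt T i k).norm (by fun_prop) isCompact_Icc)
        measurableSet_Icc
    calc ‖∑ k, ∫ s, μ.dens s i k * g (s + t) k ∂μ.base‖
        ≤ ∑ k, ∫ s, (Set.Icc 0 T).indicator (fun s => ‖μ.dens s i k‖ *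
          (C * Real.exp (-ω * (s + t)))) s ∂μ.base := by
          refine norm_sum_le_of_le _ fun k _ => ?_
          refine norm_integral_le_of_norm_le (hIk k) ?_
          filter_upwards [μ.ae_nonneg] with s hs
          rw [norm_mul]
          have h1 := (norm_le_pi_norm _ k).trans (hg (s + t) (add_nonneg hs ht.1))
          by_cases hsT : s + t ∈ Set.Icc 0 T
          · rw [Set.indicator_of_mem hsT] at h1
            rw [Set.indicator_of_mem (show s ∈ Set.Icc 0 T from ⟨hs, by linarith [hsT.2, ht.1]⟩)]
            exact mul_le_mul_of_nonneg_left h1 (norm_nonneg _)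
          · rw [Set.indicator_of_notMem hsT] at h1
            have h0 : ‖g (s + t) k‖ = 0 := le_antisymm h1 (norm_nonneg _)
            rw [h0, mul_zero]
            exact Set.indicator_nonneg (fun _ _ => by positivity) _
      _ = ∫ s in Set.Icc 0 T, (∑ k, ‖μ.dens s i k‖) * (C * Real.exp (-ω * (s + t))) ∂μ.base := by
          rw [← integral_finsetSum _ fun k _ => hIk k, ← integral_indicator measurableSet_Icc]
          refine integral_congr_ae (Eventually.of_forall fun s => ?_)
          by_cases hs : s ∈ Set.Icc 0 T
          · simp only [Set.indicator_of_mem hs, Finset.sum_mul]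
          · simp only [Set.indicator_of_notMem hs, Finset.sum_const_zero]
      _ ≤ ∫ s in Set.Icc 0 T, (Real.exp (-ω * s) * μ.D s) * (C * Real.exp (-ω * t)) ∂μ.base := by
          refine integral_mono_of_nonneg (Eventually.of_forall fun s => ?_) (hI.mul_const _)
            (Eventually.of_forall fun s => ?_)
          · exact mul_nonneg (Finset.sum_nonneg fun _ _ => norm_nonneg _) (by positivity)
          · have : Real.exp (-ω * (s + t)) = Real.exp (-ω * s) * Real.exp (-ω * t) := by
              rw [← Real.exp_add]; ring_nf
            have h2 := mul_le_mul_of_nonneg_right (μ.row_le_D s i)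
              (show 0 ≤ C * Real.exp (-ω * (s + t)) by positivity)
            refine h2.trans (le_of_eq ?_)
            rw [this]; ring
      _ = _ := by rw [integral_mul_const]; ring
  · rw [Set.indicator_of_notMem ht, norm_le_zero_iff]
    ext i
    by_cases h0 : 0 ≤ t
    · have hT : T < t := by
        by_contra h
        exact ht ⟨h0, not_lt.1 h⟩
      simp only [op, h0, if_true, Pi.zero_apply]
      refine Finset.sum_eq_zero fun k _ => integral_eq_zero_of_ae ?_
      filter_upwards [μ.ae_nonneg] with s hs
      have h1 := hg (s + t) (add_nonneg hs h0)
      rw [Set.indicator_of_notMem (by simp; intro; linarith), norm_le_zero_iff] at h1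
      simp [h1]
    · simp [op, h0]

theorem op_isOp (μ : LocalMatrixMeasure n) : IsOp μ.op where
  dom T := by
    refine ⟨∫ s in Set.Icc 0 T, μ.D s ∂μ.base, integral_nonneg fun s => μ.D_nonneg s, ?_⟩
    intro C g hg
    refine ⟨mul_nonneg (integral_nonneg fun s => μ.D_nonneg s) hg.1, μ.op_meas hg.2.1, fun t => ?_⟩
    have := μ.op_bound (g := g) (C := C) (T := T) (ω := 0) hg.1 (fun t _ => by simpa using hg.2.2 t) t
    simpa using this
  add C T C' T' g h hg hh := μ.op_add hg hh
  smul C T g c _ := μ.op_smul g c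
  cont l _ C T G g hG _ hlim t := μ.op_cont l hG hlim t
  shift C T g a _ ha := μ.op_shift g ha

end LocalMatrixMeasure

namespace LocalMatrixMeasure

variable {n : ℕ}

theorem Dom.zero (T : ℝ) : Dom 0 T (0 : ℝ → Fin n → ℂ) :=
  Dom.mk' le_rfl measurable_const (by simp) (by simp) (by simp)

theorem Dom.sum {ι : Type*} (F : Finset ι) {C : ι → ℝ} {T : ℝ} {G : ι → ℝ → Fin n → ℂ}
    (h : ∀ a ∈ F, Dom (C a) T (G a)) : Dom (∑ a ∈ F, C a) T (∑ a ∈ F, G a) := by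
  classical
  induction F using Finset.induction_on with
  | empty => simpa using Dom.zero T
  | insert a F ha ih =>
    rw [Finset.sum_insert ha, Finset.sum_insert ha]
    have := (h a (Finset.mem_insert_self a F)).add (ih fun b hb => h b (Finset.mem_insert_of_mem hb))
    simpa using this

namespace IsOp

variable {Φ Ψ : (ℝ → Fin n → ℂ) → (ℝ → Fin n → ℂ)}

theorem zero (h : IsOp Φ) : Φ 0 = 0 := by
  have := h.smul 0 0 0 0 (Dom.zero 0)
  simpa using this

theorem sub (h : IsOp Φ) {C T C' T' : ℝ} {g g' : ℝ → Fin n → ℂ} (hg : Dom C T g)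
    (hg' : Dom C' T' g') : Φ (g - g') = Φ g - Φ g' := by
  have h1 : g - g' = g + (-1 : ℂ) • g' := by simp [sub_eq_add_neg]
  rw [h1, h.add _ _ _ _ _ _ hg (hg'.smul _), h.smul _ _ _ _ hg']
  simp [sub_eq_add_neg]

theorem sum (h : IsOp Φ) {ι : Type*} (F : Finset ι) {C : ι → ℝ} {T : ℝ} {G : ι → ℝ → Fin n → ℂ}
    (hG : ∀ a ∈ F, Dom (C a) T (G a)) : Φ (∑ a ∈ F, G a) = ∑ a ∈ F, Φ (G a) := by
  classical
  induction F using Finset.induction_on with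
  | empty => simpa using h.zero
  | insert a F ha ih =>
    rw [Finset.sum_insert ha, Finset.sum_insert ha]
    have h1 : ∀ b ∈ F, Dom (C b) T (G b) := fun b hb => hG b (Finset.mem_insert_of_mem hb)
    rw [h.add _ _ _ _ _ _ (hG a (Finset.mem_insert_self a F)) (Dom.sum F h1), ih h1]

theorem id : IsOp (fun g : ℝ → Fin n → ℂ => g) where
  dom T := ⟨1, zero_le_one, fun C g hg => by simpa using hg⟩
  add _ _ _ _ _ _ _ _ := rfl
  smul _ _ _ _ _ := rfl
  cont _ _ _ _ _ _ _ _ h := h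
  shift _ _ _ _ _ _ := rfl

theorem comp (h : IsOp Φ) (h' : IsOp Ψ) : IsOp (fun g => Φ (Ψ g)) where
  dom T := by
    obtain ⟨K, hK, hd⟩ := h.dom T
    obtain ⟨K', hK', hd'⟩ := h'.dom T
    refine ⟨K * K', mul_nonneg hK hK', fun C g hg => ?_⟩
    rw [mul_assoc]
    exact hd _ _ (hd' _ _ hg)
  add C T C' T' g g' hg hg' := by
    obtain ⟨K, hK, hd⟩ := h'.dom T
    obtain ⟨K', hK', hd'⟩ := h'.dom T'
    rw [h'.add _ _ _ _ _ _ hg hg', h.add _ _ _ _ _ _ (hd _ _ hg) (hd' _ _ hg')]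
  smul C T g c hg := by
    obtain ⟨K, hK, hd⟩ := h'.dom T
    rw [h'.smul _ _ _ _ hg, h.smul _ _ _ _ (hd _ _ hg)]
  cont l _ C T G g hG hg hl := by
    obtain ⟨K, hK, hd⟩ := h'.dom T
    exact h.cont l _ _ _ _ (fun m => hd _ _ (hG m)) (hd _ _ hg) (h'.cont l C T G g hG hg hl)
  shift C T g a hg ha := by
    obtain ⟨K, hK, hd⟩ := h'.dom T
    rw [h'.shift _ _ _ _ hg ha, h.shift _ _ _ _ (hd _ _ hg) ha]

theorem subOp (h : IsOp Φ) (h' : IsOp Ψ) : IsOp (fun g => Φ g - Ψ g) where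
  dom T := by
    obtain ⟨K, hK, hd⟩ := h.dom T
    obtain ⟨K', hK', hd'⟩ := h'.dom T
    refine ⟨K + K', add_nonneg hK hK', fun C g hg => ?_⟩
    have := (hd _ _ hg).sub (hd' _ _ hg)
    rwa [max_self, ← add_mul] at this
  add C T C' T' g g' hg hg' := by
    rw [h.add _ _ _ _ _ _ hg hg', h'.add _ _ _ _ _ _ hg hg']
    abel
  smul C T g c hg := by
    rw [h'.smul _ _ _ _ hg, h.smul _ _ _ _ hg, smul_sub]
  cont l _ C T G g hG hg hl t :=
    (h.cont l C T G g hG hg hl t).sub (h'.cont l C T G g hG hg hl t)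
  shift C T g a hg ha := by
    rw [h'.shift _ _ _ _ hg ha, h.shift _ _ _ _ hg ha]
    ext t i
    by_cases ht : 0 ≤ t <;> simp [LocalMatrixMeasure.shift, ht]

end IsOp

theorem shift_ind {E : Set ℝ} (j : Fin n) (t : ℝ) :
    shift t (ind E j) = ind ((· + t) ⁻¹' E ∩ Set.Ici 0) j := by
  classical
  ext s i
  by_cases hs : 0 ≤ s <;> by_cases hE : s + t ∈ E <;>
    simp [shift, ind, hs, hE]

theorem IsOp.ext_ind {Φ Ψ : (ℝ → Fin n → ℂ) → (ℝ → Fin n → ℂ)} (h : IsOp Φ) (h' : IsOp Ψ)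
    (heq : ∀ (E : Set ℝ) (T : ℝ) (j : Fin n), MeasurableSet E → E ⊆ Set.Icc 0 T →
      Φ (ind E j) 0 = Ψ (ind E j) 0) {E : Set ℝ} {T : ℝ} (hE : MeasurableSet E)
    (hET : E ⊆ Set.Icc 0 T) (j : Fin n) : Φ (ind E j) = Ψ (ind E j) := by
  obtain ⟨K, hK, hd⟩ := h.dom T
  obtain ⟨K', hK', hd'⟩ := h'.dom T
  have hi := ind_dom hE hET j
  funext t
  rcases lt_or_ge t 0 with ht | ht
  · rw [(hd _ _ hi).zero_of_neg ht, (hd' _ _ hi).zero_of_neg ht]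
  · have h1 := congrFun (h.shift _ _ _ _ hi ht) 0
    have h2 := congrFun (h'.shift _ _ _ _ hi ht) 0
    rw [shift_ind] at h1 h2
    have h3 := heq ((· + t) ⁻¹' E ∩ Set.Ici 0) T j
      ((measurable_id.add_const t hE).inter measurableSet_Ici) (fun s hs => ⟨hs.2, by
        have := (hET hs.1).2
        simp only at this
        linarith⟩)
    rw [h1, h2] at h3
    simpa [LocalMatrixMeasure.shift] using h3

theorem IsOp.ext_simple {Φ Ψ : (ℝ → Fin n → ℂ) → (ℝ → Fin n → ℂ)} (h : IsOp Φ) (h' : IsOp Ψ)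
    (heq : ∀ (E : Set ℝ) (T : ℝ) (j : Fin n), MeasurableSet E → E ⊆ Set.Icc 0 T →
      Φ (ind E j) 0 = Ψ (ind E j) 0) {C T : ℝ} (φ : SimpleFunc ℝ (Fin n → ℂ)) :
    Dom C T φ → Φ φ = Ψ φ := by
  induction φ using SimpleFunc.induction with
  | const c hs =>
    rename_i s
    intro hD
    by_cases hc : c = 0
    · have : (⇑(SimpleFunc.piecewise s hs (SimpleFunc.const ℝ c) (SimpleFunc.const ℝ 0)) :
          ℝ → Fin n → ℂ) = 0 := by
        ext t i
        simp [hc]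
      rw [this, h.zero, h'.zero]
    · have hsT : s ⊆ Set.Icc 0 T := by
        intro t ht
        by_contra hn
        have := hD.2.2 t
        rw [Set.indicator_of_notMem hn, norm_le_zero_iff] at this
        simp [ht] at this
        exact hc this
      have hrep : (⇑(SimpleFunc.piecewise s hs (SimpleFunc.const ℝ c) (SimpleFunc.const ℝ 0)) :
          ℝ → Fin n → ℂ) = ∑ j, c j • ind s j := by
        ext t i
        by_cases ht : t ∈ s <;> simp [ht, ind, Finset.sum_apply, Pi.single_apply]
      have hi := fun j => ind_dom (n := n) hs hsT j
      rw [hrep, h.sum (C := fun j => ‖c j‖ * 1) _ fun j _ => (hi j).smul (c j),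
        h'.sum (C := fun j => ‖c j‖ * 1) _ fun j _ => (hi j).smul (c j)]
      refine Finset.sum_congr rfl fun j _ => ?_
      rw [h.smul _ _ _ _ (hi j), h'.smul _ _ _ _ (hi j), h.ext_ind h' heq hs hsT j]
  | add hdis ihf ihg =>
    rename_i f g
    intro hD
    have hz : ∀ t, f t = 0 ∨ g t = 0 := fun t => by
      by_contra hcon
      rw [not_or] at hcon
      exact Set.disjoint_left.1 hdis hcon.1 hcon.2
    have hf : Dom C T f := by
      refine ⟨hD.1, f.measurable, fun t => ?_⟩
      have := hD.2.2 t
      rcases hz t with h0 | h0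
      · rw [h0, norm_zero]; exact (norm_nonneg _).trans this
      · simpa [h0] using this
    have hg : Dom C T g := by
      refine ⟨hD.1, g.measurable, fun t => ?_⟩
      have := hD.2.2 t
      rcases hz t with h0 | h0
      · simpa [h0] using this
      · rw [h0, norm_zero]; exact (norm_nonneg _).trans this
    rw [SimpleFunc.coe_add, h.add _ _ _ _ _ _ hf hg, h'.add _ _ _ _ _ _ hf hg, ihf hf, ihg hg]

theorem IsOp.ext {Φ Ψ : (ℝ → Fin n → ℂ) → (ℝ → Fin n → ℂ)} (h : IsOp Φ) (h' : IsOp Ψ)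
    (heq : ∀ (E : Set ℝ) (T : ℝ) (j : Fin n), MeasurableSet E → E ⊆ Set.Icc 0 T →
      Φ (ind E j) 0 = Ψ (ind E j) 0) {C T : ℝ} {g : ℝ → Fin n → ℂ} (hg : Dom C T g) :
    Φ g = Ψ g := by
  let G : ℕ → SimpleFunc ℝ (Fin n → ℂ) := fun m =>
    SimpleFunc.approxOn g hg.2.1 Set.univ 0 (Set.mem_univ _) m
  have hG : ∀ m, Dom (C + C) T (G m) := fun m => by
    have hb : ∀ t, ‖G m t‖ ≤ ‖g t‖ + ‖g t‖ := fun t =>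
      SimpleFunc.norm_approxOn_zero_le hg.2.1 (Set.mem_univ _) t m
    refine Dom.mk' (add_nonneg hg.1 hg.1) (G m).measurable ?_ ?_ ?_
    · intro t ht
      have := hb t
      rw [hg.zero_of_neg ht] at this
      simpa using this
    · intro t ht
      have := hb t
      rw [hg.zero_of_gt ht] at this
      simpa using this
    · intro t
      exact (hb t).trans (add_le_add (hg.le t) (hg.le t))
  have hlim : ∀ t, Tendsto (fun m => G m t) atTop (𝓝 (g t)) := fun t =>
    SimpleFunc.tendsto_approxOn hg.2.1 (Set.mem_univ _) (by simp)
  have hg' : Dom (C + C) T g := hg.mono (by linarith [hg.1]) le_rfl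
  funext t
  have h1 := h.cont atTop _ _ _ _ hG hg' hlim t
  have h2 := h'.cont atTop _ _ _ _ hG hg' hlim t
  refine tendsto_nhds_unique h1 (h2.congr fun m => ?_)
  rw [h.ext_simple h' heq (G m) (hG m)]

/-- value of an operator at an indicator -/
theorem op_ind (μ : LocalMatrixMeasure n) {E : Set ℝ} (hE : MeasurableSet E) (i j : Fin n) {t : ℝ}
    (ht : 0 ≤ t) : μ.op (ind E j) t i = μ.val ((· + t) ⁻¹' E ∩ Set.Ici 0) i j := by
  have hm : MeasurableSet ((· + t) ⁻¹' E ∩ Set.Ici 0) :=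
    (measurable_id.add_const t hE).inter measurableSet_Ici
  simp only [op, ht, if_true, val, Matrix.of_apply]
  rw [Finset.sum_eq_single j, ← integral_indicator hm]
  · refine integral_congr_ae ?_
    filter_upwards [μ.ae_nonneg] with s hs
    by_cases hsE : s + t ∈ E <;> simp [ind, hsE, hs]
  · intro k _ hk
    refine integral_eq_zero_of_ae (Eventually.of_forall fun s => ?_)
    by_cases hsE : s + t ∈ E <;> simp [ind, hsE, hk]
  · simp

theorem val_inter (μ : LocalMatrixMeasure n) {E : Set ℝ} :
    μ.val (E ∩ Set.Ici 0) = μ.val E := by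
  ext i j
  simp only [val, Matrix.of_apply]
  congr 1
  refine Measure.restrict_congr_set ?_
  filter_upwards [μ.ae_nonneg] with s hs
  exact propext (and_iff_left hs)

theorem op_ind_zero (μ : LocalMatrixMeasure n) {E : Set ℝ} (hE : MeasurableSet E) (i j : Fin n) :
    μ.op (ind E j) 0 i = μ.val E i j := by
  rw [μ.op_ind hE i j le_rfl, val_inter]
  simp

theorem restrict_base (μ : LocalMatrixMeasure n) : μ.base.restrict (Set.Ici 0) = μ.base :=
  Measure.restrict_eq_self_of_ae_mem μ.ae_nonneg

theorem op_op_ind_zero (μ ν : LocalMatrixMeasure n) {E : Set ℝ} (hE : MeasurableSet E)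
    (i j : Fin n) : μ.op (ν.op (ind E j)) 0 i = μ.conv ν E i j := by
  simp only [conv, Matrix.of_apply, restrict_base]
  rw [op, if_pos le_rfl]
  refine Finset.sum_congr rfl fun k _ => integral_congr_ae ?_
  filter_upwards [μ.ae_nonneg] with s hs
  simp only [add_zero]
  rw [ν.op_ind hE k j hs]

theorem conv_inter (μ ν : LocalMatrixMeasure n) {E : Set ℝ} :
    μ.conv ν (E ∩ Set.Ici 0) = μ.conv ν E := by
  ext i j
  simp only [conv, Matrix.of_apply, restrict_base]
  refine Finset.sum_congr rfl fun k _ => integral_congr_ae ?_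
  filter_upwards [μ.ae_nonneg] with s hs
  have he : (fun x => x + s) ⁻¹' (E ∩ Set.Ici 0) ∩ Set.Ici 0 =
      (fun x => x + s) ⁻¹' E ∩ Set.Ici 0 := by
    ext u
    constructor
    · rintro ⟨⟨h1, _⟩, h2⟩; exact ⟨h1, h2⟩
    · rintro ⟨h1, h2⟩; exact ⟨⟨h1, add_nonneg h2 hs⟩, h2⟩
  rw [he]

theorem bdd_subset {E : Set ℝ} (hE : Bornology.IsBounded E) :
    ∃ T : ℝ, E ∩ Set.Ici 0 ⊆ Set.Icc 0 T := by
  obtain ⟨T, hT⟩ := hE.bddAbove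
  exact ⟨T, fun t ht => ⟨ht.2, hT ht.1⟩⟩

theorem isResolvent_iff (μ ρ : LocalMatrixMeasure n) : IsResolvent μ ρ ↔
    ∀ C T g, Dom C T g → ρ.op g - μ.op (ρ.op g) = μ.op g ∧ ρ.op g - ρ.op (μ.op g) = μ.op g := by
  constructor
  · intro h C T g hg
    refine ⟨?_, ?_⟩
    · refine IsOp.ext (ρ.op_isOp.subOp (μ.op_isOp.comp ρ.op_isOp)) μ.op_isOp ?_ hg
      intro E T j hE hET
      have h1 := (h E hE ((Metric.isBounded_Icc 0 T).subset hET)).1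
      ext i
      rw [μ.op_ind_zero hE, ← h1]
      simp [op_ind_zero _ hE, op_op_ind_zero _ _ hE]
    · refine IsOp.ext (ρ.op_isOp.subOp (ρ.op_isOp.comp μ.op_isOp)) μ.op_isOp ?_ hg
      intro E T j hE hET
      have h1 := (h E hE ((Metric.isBounded_Icc 0 T).subset hET)).2
      ext i
      rw [μ.op_ind_zero hE, ← h1]
      simp [op_ind_zero _ hE, op_op_ind_zero _ _ hE]
  · intro h E hE hb
    obtain ⟨T, hT⟩ := bdd_subset hb
    have hE' := hE.inter (measurableSet_Ici (a := (0 : ℝ)))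
    constructor
    · ext i j
      have := congrFun (congrFun (h 1 T _ (ind_dom hE' hT j)).1 0) i
      rw [μ.op_ind_zero hE', Pi.sub_apply, Pi.sub_apply, op_ind_zero _ hE', op_op_ind_zero _ _ hE',
        val_inter, val_inter, conv_inter] at this
      exact this
    · ext i j
      have := congrFun (congrFun (h 1 T _ (ind_dom hE' hT j)).2 0) i
      rw [μ.op_ind_zero hE', Pi.sub_apply, Pi.sub_apply, op_ind_zero _ hE', op_op_ind_zero _ _ hE',
        val_inter, val_inter, conv_inter] at this
      exact this

theorem resolvent_unique (μ ρ₁ ρ₂ : LocalMatrixMeasure n) (h₁ : IsResolvent μ ρ₁)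
    (h₂ : IsResolvent μ ρ₂) (E : Set ℝ) (hE : MeasurableSet E) (hb : Bornology.IsBounded E) :
    ρ₁.val E = ρ₂.val E := by
  rw [isResolvent_iff] at h₁ h₂
  obtain ⟨T, hT⟩ := bdd_subset hb
  have hE' := hE.inter (measurableSet_Ici (a := (0 : ℝ)))
  ext i j
  have hg := ind_dom hE' hT j
  rw [← ρ₁.val_inter, ← ρ₂.val_inter, ← op_ind_zero _ hE', ← op_ind_zero _ hE']
  suffices hs : ρ₁.op (ind (E ∩ Set.Ici 0) j) = ρ₂.op (ind (E ∩ Set.Ici 0) j) by rw [hs]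
  generalize ind (E ∩ Set.Ici 0) j = g at hg
  obtain ⟨K, hK, hd⟩ := ρ₁.op_isOp.dom T
  obtain ⟨K', hK', hd'⟩ := μ.op_isOp.dom T
  have e1 := (h₁ _ _ _ hg).1
  have e2 := (h₂ _ _ _ hg).2
  have e3 := (h₂ _ _ _ (hd _ _ hg)).2
  have e4 : μ.op (ρ₁.op g) = ρ₁.op g - μ.op g := by rw [← e1]; abel
  rw [e4, ρ₂.op_isOp.sub (hd _ _ hg) (hd' _ _ hg)] at e3
  have e5 : ρ₂.op (μ.op g) = ρ₁.op g - μ.op g := by rw [← e3]; abel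
  rw [e5] at e2
  have : ρ₂.op g = ρ₁.op g := by
    have := eq_add_of_sub_eq e2
    rw [this]; abel
  exact this.symm

theorem det_ne_zero_of_resolvent (μ ρ : LocalMatrixMeasure n) (h : IsResolvent μ ρ) :
    Matrix.det ((1 : Matrix (Fin n) (Fin n) ℂ) - μ.val {0}) ≠ 0 := by
  have h1 := (h {0} (measurableSet_singleton 0) Bornology.isBounded_singleton).1
  have hc : μ.conv ρ {0} = μ.val {0} * ρ.val {0} := by
    ext i j
    simp only [conv, Matrix.of_apply, restrict_base, Matrix.mul_apply]
    refine Finset.sum_congr rfl fun k _ => ?_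
    have : μ.val {0} i k = ∫ s in {0}, μ.dens s i k ∂μ.base := rfl
    rw [this, ← integral_mul_const, ← integral_indicator (measurableSet_singleton 0)]
    refine integral_congr_ae ?_
    filter_upwards [μ.ae_nonneg] with s hs
    by_cases h0 : s = 0
    · subst h0
      simp only [add_zero, Set.preimage_id', Set.mem_singleton_iff, Set.indicator_of_mem]
      rw [val_inter]
    · have he : (fun x => x + s) ⁻¹' {0} ∩ Set.Ici 0 = ∅ := by
        ext u
        simp only [Set.mem_inter_iff, Set.mem_preimage, Set.mem_singleton_iff, Set.mem_Ici,
          Set.mem_empty_iff_false, iff_false, not_and, not_le]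
        intro hu
        have : 0 < s := lt_of_le_of_ne hs (Ne.symm h0)
        linarith
      rw [he]
      simp [h0, val]
  rw [hc] at h1
  have h2 : (1 - μ.val {0}) * (1 + ρ.val {0}) = 1 := by
    rw [sub_mul, one_mul, mul_add, mul_one]
    have : ρ.val {0} = μ.val {0} + μ.val {0} * ρ.val {0} := (eq_add_of_sub_eq h1)
    nth_rewrite 1 [this]
    abel
  intro h3
  have := congrArg Matrix.det h2
  rw [Matrix.det_mul, h3, zero_mul, Matrix.det_one] at this
  exact zero_ne_one this

end LocalMatrixMeasure

namespace LocalMatrixMeasure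

variable {n : ℕ} {Φ : (ℝ → Fin n → ℂ) → (ℝ → Fin n → ℂ)}

theorem ind_union (F : Finset ℕ) {E : ℕ → Set ℝ} (hd : Pairwise (Function.onFun Disjoint E))
    (j : Fin n) : ∑ m ∈ F, ind (E m) j = ind (⋃ m ∈ F, E m) j := by
  classical
  unfold ind
  funext t
  rw [Finset.sum_apply, Finset.indicator_biUnion_apply]
  exact fun a _ b _ hab => hd hab

theorem IsOp.hasSum (h : IsOp Φ) {E : ℕ → Set ℝ} {T : ℝ} (hm : ∀ m, MeasurableSet (E m))
    (hT : ∀ m, E m ⊆ Set.Icc 0 T) (hd : Pairwise (Function.onFun Disjoint E)) (j : Fin n) :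
    HasSum (fun m => Φ (ind (E m) j) 0) (Φ (ind (⋃ m, E m) j) 0) := by
  have hG : ∀ F : Finset ℕ, Dom 1 T (∑ m ∈ F, ind (E m) j) := fun F => by
    rw [ind_union F hd j]
    exact ind_dom (Finset.measurableSet_biUnion _ fun m _ => hm m)
      (Set.iUnion₂_subset fun m _ => hT m) j
  have hlim : ∀ t, Tendsto (fun F : Finset ℕ => (∑ m ∈ F, ind (E m) j) t) atTop
      (𝓝 (ind (⋃ m, E m) j t)) := by
    intro t
    have : HasSum (fun m => ind (E m) j t) (ind (⋃ m, E m) j t) := by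
      by_cases ht : ∃ m, t ∈ E m
      · obtain ⟨m, ht⟩ := ht
        have h1 : ind (⋃ m, E m) j t = ind (E m) j t := by
          simp only [ind]
          rw [Set.indicator_of_mem ht, Set.indicator_of_mem (Set.mem_iUnion.2 ⟨m, ht⟩)]
        rw [h1]
        refine hasSum_single m fun b hb => ?_
        exact Set.indicator_of_notMem (fun hb' => Set.disjoint_left.1 (hd hb) hb' ht) _
      · have h1 : ind (⋃ m, E m) j t = 0 :=
          Set.indicator_of_notMem (fun hb => ht (Set.mem_iUnion.1 hb)) _
        have h2 : (fun m => ind (E m) j t) = fun _ => 0 := by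
          funext m
          exact Set.indicator_of_notMem (fun hb => ht ⟨m, hb⟩) _
        rw [h1, h2]
        exact hasSum_zero
    have h3 : Tendsto (fun F : Finset ℕ => ∑ m ∈ F, ind (E m) j t) atTop
      (𝓝 (ind (⋃ m, E m) j t)) := this
    simpa only [Finset.sum_apply] using h3
  have key := h.cont atTop 1 T _ _ hG (ind_dom (MeasurableSet.iUnion hm)
      (Set.iUnion_subset hT) j) hlim 0
  have : Tendsto (fun F : Finset ℕ => ∑ m ∈ F, Φ (ind (E m) j) 0) atTop
      (𝓝 (Φ (ind (⋃ m, E m) j) 0)) := by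
    refine key.congr fun F => ?_
    rw [h.sum (C := fun _ => 1) F (T := T) fun m _ => ind_dom (hm m) (hT m) j, Finset.sum_apply]
  exact this

theorem slice_subset (N : ℕ) (E : Set ℝ) :
    E ∩ Set.Ico (N : ℝ) (N + 1) ⊆ Set.Icc 0 ((N : ℝ) + 1) :=
  fun _ ht => ⟨le_trans (Nat.cast_nonneg N) ht.2.1, ht.2.2.le⟩

open Classical in
/-- Signed measure on a slice. -/
noncomputable def sm (h : IsOp Φ) (r : ℂ →L[ℝ] ℝ) (N : ℕ) (i j : Fin n) : SignedMeasure ℝ where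
  measureOf' E := if MeasurableSet E then r (Φ (ind (E ∩ Set.Ico (N : ℝ) (N + 1)) j) 0 i) else 0
  empty' := by
    have : ind (∅ : Set ℝ) j = 0 := by unfold ind; exact Set.indicator_empty _
    simp [this, h.zero]
  not_measurable' E hE := by simp [hE]
  m_iUnion' E hm hd := by
    simp only [hm, MeasurableSet.iUnion hm, if_true]
    have := h.hasSum (E := fun m => E m ∩ Set.Ico (N : ℝ) (N + 1)) (T := (N : ℝ) + 1)
      (fun m => (hm m).inter measurableSet_Ico) (fun m => slice_subset N (E m))
      (fun a b hab => (hd hab).mono Set.inter_subset_left Set.inter_subset_left) j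
    rw [← Set.iUnion_inter] at this
    exact (Pi.hasSum.1 this i).mapL r

theorem exists_slice_density (h : IsOp Φ) : ∃ b : Measure ℝ, IsFiniteMeasure b ∧
    ∃ d : ℕ → Fin n → Fin n → ℝ → ℂ, (∀ N i j, Measurable (d N i j)) ∧
    (∀ N i j, Integrable (d N i j) b) ∧
    ∀ (N : ℕ) i j E, MeasurableSet E →
      Φ (ind (E ∩ Set.Ico (N : ℝ) (N + 1)) j) 0 i = ∫ t in E, d N i j t ∂b := by
  let tot : ℕ × Fin n × Fin n → Measure ℝ := fun p =>
    (sm h Complex.reCLM p.1 p.2.1 p.2.2).totalVariation +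
      (sm h Complex.imCLM p.1 p.2.1 p.2.2).totalVariation
  obtain ⟨b, hb, hac, -⟩ := exists_isFiniteMeasure_absolutelyContinuous (Measure.sum tot)
  have htot : ∀ p, tot p ≪ b := fun p => (Measure.absolutelyContinuous_of_le
    (Measure.le_sum tot p)).trans hac
  have hre : ∀ N i j, b.withDensityᵥ ((sm h Complex.reCLM N i j).rnDeriv b) =
      sm h Complex.reCLM N i j := fun N i j => by
    apply SignedMeasure.withDensityᵥ_rnDeriv_eq
    rw [SignedMeasure.absolutelyContinuous_ennreal_iff]
    rw [VectorMeasure.ennrealToMeasure_toENNRealVectorMeasure]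
    refine Measure.AbsolutelyContinuous.trans ?_ (htot (N, i, j))
    exact Measure.absolutelyContinuous_of_le (Measure.le_add_right le_rfl)
  have him : ∀ N i j, b.withDensityᵥ ((sm h Complex.imCLM N i j).rnDeriv b) =
      sm h Complex.imCLM N i j := fun N i j => by
    apply SignedMeasure.withDensityᵥ_rnDeriv_eq
    rw [SignedMeasure.absolutelyContinuous_ennreal_iff]
    rw [VectorMeasure.ennrealToMeasure_toENNRealVectorMeasure]
    refine Measure.AbsolutelyContinuous.trans ?_ (htot (N, i, j))
    exact Measure.absolutelyContinuous_of_le (Measure.le_add_left le_rfl)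
  refine ⟨b, hb, fun N i j t => ((sm h Complex.reCLM N i j).rnDeriv b t : ℂ) +
    ((sm h Complex.imCLM N i j).rnDeriv b t : ℂ) * Complex.I, ?_, ?_, ?_⟩
  · intro N i j
    exact (Complex.measurable_ofReal.comp (SignedMeasure.measurable_rnDeriv _ _)).add
      ((Complex.measurable_ofReal.comp (SignedMeasure.measurable_rnDeriv _ _)).mul_const _)
  · intro N i j
    exact ((SignedMeasure.integrable_rnDeriv _ _).ofReal).add
      ((SignedMeasure.integrable_rnDeriv _ _).ofReal.mul_const _)
  · intro N i j E hE
    have h1 : Integrable (fun t => ((sm h Complex.reCLM N i j).rnDeriv b t : ℂ)) (b.restrict E) :=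
      ((SignedMeasure.integrable_rnDeriv _ _).ofReal).restrict
    have h2 : Integrable (fun t => ((sm h Complex.imCLM N i j).rnDeriv b t : ℂ) * Complex.I)
      (b.restrict E) := ((SignedMeasure.integrable_rnDeriv _ _).ofReal.mul_const _).restrict
    rw [integral_add h1 h2, integral_mul_const, integral_complex_ofReal, integral_complex_ofReal,
      ← withDensityᵥ_apply (SignedMeasure.integrable_rnDeriv _ _) hE,
      ← withDensityᵥ_apply (SignedMeasure.integrable_rnDeriv _ _) hE, hre, him]
    have e : ∀ r, (sm h r N i j) E = r (Φ (ind (E ∩ Set.Ico (N : ℝ) (N + 1)) j) 0 i) := fun r => by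
      classical
      change (if MeasurableSet E then r (Φ (ind (E ∩ Set.Ico (N : ℝ) (N + 1)) j) 0 i) else 0) = _
      rw [if_pos hE]
    rw [e, e]
    simp [Complex.re_add_im]

theorem slice_floor {t : ℝ} {N : ℕ} (ht : t ∈ Set.Ico (N : ℝ) (N + 1)) : ⌊t⌋₊ = N :=
  (Nat.floor_eq_iff (le_trans (Nat.cast_nonneg N) ht.1)).2 ht

theorem slice_disjoint : Pairwise (Function.onFun Disjoint fun N : ℕ => Set.Ico (N : ℝ) (N + 1)) := by
  intro a b hab
  refine Set.disjoint_left.2 fun t ha hb => hab ?_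
  rw [← slice_floor ha, slice_floor hb]

theorem slice_cover {E : Set ℝ} {T : ℝ} (hE : E ⊆ Set.Icc 0 T) :
    E = ⋃ N ∈ Finset.range (⌊T⌋₊ + 1), E ∩ Set.Ico (N : ℝ) (N + 1) := by
  ext t
  simp only [Set.mem_iUnion, Finset.mem_range]
  constructor
  · intro ht
    have h := hE ht
    exact ⟨⌊t⌋₊, Nat.lt_succ_of_le (Nat.floor_le_floor h.2), ht, Nat.floor_le h.1, Nat.lt_floor_add_one t⟩
  · rintro ⟨_, _, h⟩
    exact h.1

theorem IsOp.exists_measure (h : IsOp Φ) : ∃ ρ : LocalMatrixMeasure n,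
    ∀ (E : Set ℝ) (T : ℝ), MeasurableSet E → E ⊆ Set.Icc 0 T → ∀ i j,
      ρ.val E i j = Φ (ind E j) 0 i := by
  obtain ⟨b, hb, d, dm, di, hd⟩ := exists_slice_density h
  have hslice : ∀ (E : Set ℝ), MeasurableSet E → ∀ (N : ℕ) i j,
      IntegrableOn (fun t => d ⌊t⌋₊ i j t) (E ∩ Set.Ico (N : ℝ) (N + 1)) b := by
    intro E hE N i j
    refine ((di N i j).integrableOn).congr_fun ?_ (hE.inter measurableSet_Ico)
    intro t ht
    simp only [slice_floor ht.2]
  have hfl : ∀ (E : Set ℝ) (T : ℝ), MeasurableSet E → E ⊆ Set.Icc 0 T → ∀ i j,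
      IntegrableOn (fun t => d ⌊t⌋₊ i j t) E b := by
    intro E T hE hET i j
    rw [slice_cover hET, integrableOn_finset_iUnion]
    exact fun N _ => hslice E hE N i j
  refine ⟨⟨b.restrict (Set.Ici 0), fun t i j => d ⌊t⌋₊ i j t, ?_, ?_, ?_⟩, ?_⟩
  · intro i j
    have : Measurable (Function.uncurry fun (N : ℕ) (t : ℝ) => d N i j t) :=
      measurable_from_prod_countable_right fun N => dm N i j
    exact this.comp (Nat.measurable_floor.prodMk measurable_id)
  · intro T i j
    have := hfl (Set.Icc 0 T) T measurableSet_Icc subset_rfl i j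
    exact this.mono_measure Measure.restrict_le_self
  · rw [Measure.restrict_apply measurableSet_Iio]
    have : Set.Iio (0 : ℝ) ∩ Set.Ici 0 = ∅ := by
      ext t; simp
    rw [this, measure_empty]
  · intro E T hE hET i j
    simp only [val, Matrix.of_apply]
    rw [Measure.restrict_restrict hE, Set.inter_eq_left.2 (show E ⊆ Set.Ici 0 from fun t ht => (hET ht).1)]
    have hdis : Pairwise (Function.onFun Disjoint fun N : ℕ => E ∩ Set.Ico (N : ℝ) (N + 1)) :=
      fun a b hab => (slice_disjoint hab).mono Set.inter_subset_right Set.inter_subset_right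
    have hL : ind E j = ∑ N ∈ Finset.range (⌊T⌋₊ + 1), ind (E ∩ Set.Ico (N : ℝ) (N + 1)) j := by
      rw [ind_union _ hdis, ← slice_cover hET]
    rw [hL, h.sum (C := fun _ => 1) (T := T) _ fun N _ => ind_dom (hE.inter measurableSet_Ico)
      (Set.inter_subset_left.trans hET) j]
    rw [Finset.sum_apply, Finset.sum_apply]
    have hR : ∫ t in E, d ⌊t⌋₊ i j t ∂b = ∑ N ∈ Finset.range (⌊T⌋₊ + 1),
        ∫ t in E ∩ Set.Ico (N : ℝ) (N + 1), d ⌊t⌋₊ i j t ∂b := by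
      conv_lhs => rw [slice_cover hET]
      exact integral_biUnion_finset _ (fun N _ => hE.inter measurableSet_Ico)
        (fun a _ b _ hab => hdis hab) (fun N _ => hslice E hE N i j)
    rw [hR]
    refine Finset.sum_congr rfl fun N _ => ?_
    have h1 := hd N i j (E ∩ Set.Ico (N : ℝ) (N + 1)) (hE.inter measurableSet_Ico)
    rw [Set.inter_assoc, Set.inter_self] at h1
    rw [h1]
    refine setIntegral_congr_fun (hE.inter measurableSet_Ico) fun t ht => ?_
    simp only [slice_floor ht.2]

end LocalMatrixMeasure

namespace LocalMatrixMeasure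

variable {n : ℕ}

/-- A matrix times the Dirac measure at zero. -/
noncomputable def diracM (B : Matrix (Fin n) (Fin n) ℂ) : LocalMatrixMeasure n where
  base := Measure.dirac 0
  dens := fun _ i j => B i j
  meas _ _ := measurable_const
  locInt _ _ _ := (integrable_const _).integrableOn
  supp := by simp

theorem diracM_op (B : Matrix (Fin n) (Fin n) ℂ) {C T : ℝ} {g : ℝ → Fin n → ℂ} (hg : Dom C T g) :
    (diracM B).op g = fun t => B.mulVec (g t) := by
  ext t i
  by_cases ht : 0 ≤ t
  · simp [op, ht, diracM, Matrix.mulVec, dotProduct]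
  · simp [op, ht, hg.zero_of_neg (not_le.1 ht)]

/-- The part of the measure on `(0,∞)`. -/
noncomputable def pos (μ : LocalMatrixMeasure n) : LocalMatrixMeasure n where
  base := μ.base
  dens := fun s i j => if 0 < s then μ.dens s i j else 0
  meas i j := Measurable.ite measurableSet_Ioi (μ.meas i j) measurable_const
  locInt T i j := by
    have := (μ.locInt T i j).indicator (measurableSet_Ioi (a := (0 : ℝ)))
    refine Integrable.congr this (Eventually.of_forall fun s => ?_)
    by_cases hs : 0 < s <;> simp [hs]
  supp := μ.supp

/-- Left multiplication by a matrix. -/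
noncomputable def lmul (B : Matrix (Fin n) (Fin n) ℂ) (μ : LocalMatrixMeasure n) :
    LocalMatrixMeasure n where
  base := μ.base
  dens := fun s i j => ∑ l, B i l * μ.dens s l j
  meas i j := Finset.measurable_sum _ fun l _ => (μ.meas l j).const_mul _
  locInt T i j := integrable_finsetSum _ fun l _ => (μ.locInt T l j).const_mul _
  supp := μ.supp

theorem op_eq_pos (μ : LocalMatrixMeasure n) {C T : ℝ} {g : ℝ → Fin n → ℂ} (hg : Dom C T g) :
    μ.op g = (diracM (μ.val {0})).op g + μ.pos.op g := by
  rw [diracM_op _ hg]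
  ext t i
  by_cases ht : 0 ≤ t
  · simp only [op, ht, if_true, Pi.add_apply, Matrix.mulVec, dotProduct]
    rw [← Finset.sum_add_distrib]
    refine Finset.sum_congr rfl fun k _ => ?_
    have hI := hg.integrable μ ht i k
    have hI' : Integrable (fun s => μ.pos.dens s i k * g (s + t) k) μ.base :=
      hg.integrable μ.pos ht i k
    have h1 : μ.val {0} i k * g t k = ∫ s, ({0} : Set ℝ).indicator
        (fun s => μ.dens s i k * g (s + t) k) s ∂μ.base := by
      rw [integral_indicator (measurableSet_singleton _)]
      have : μ.val {0} i k = ∫ s in {0}, μ.dens s i k ∂μ.base := rfl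
      rw [this, ← integral_mul_const]
      refine setIntegral_congr_fun (measurableSet_singleton _) fun s hs => ?_
      rw [Set.mem_singleton_iff] at hs
      simp [hs]
    have h2 : μ.pos.base = μ.base := rfl
    rw [h1, h2, ← integral_add (hI.indicator (measurableSet_singleton _)) hI']
    refine integral_congr_ae ?_
    filter_upwards [μ.ae_nonneg] with s hs
    rcases hs.eq_or_lt with h0 | h0
    · simp [← h0, pos]
    · simp [h0.ne', h0, pos]
  · simp [op, ht, hg.zero_of_neg (not_le.1 ht)]

theorem lmul_op (B : Matrix (Fin n) (Fin n) ℂ) (μ : LocalMatrixMeasure n) {C T : ℝ}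
    {g : ℝ → Fin n → ℂ} (hg : Dom C T g) :
    (lmul B μ).op g = (diracM B).op (μ.op g) := by
  obtain ⟨K, hK, hd⟩ := μ.op_isOp.dom T
  rw [diracM_op _ (hd _ _ hg)]
  ext t i
  by_cases ht : 0 ≤ t
  · simp only [op, ht, if_true, Matrix.mulVec, dotProduct, lmul, Finset.sum_mul, Finset.mul_sum]
    rw [Finset.sum_comm]
    refine Finset.sum_congr rfl fun k _ => ?_
    rw [integral_finsetSum]
    · refine Finset.sum_congr rfl fun l _ => ?_
      simp only [mul_assoc, integral_const_mul]
    · intro l _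
      simp only [mul_assoc]
      exact (hg.integrable μ ht l k).const_mul _
  · simp [op, ht, Matrix.mulVec, dotProduct]

theorem decay (ν : LocalMatrixMeasure n) (h0 : ν.D 0 = 0) (T : ℝ) : ∃ K : ℝ, 0 ≤ K ∧
    ∀ C g k, Dom C T g → Dom (K * (1 / 2) ^ k * C) T (ν.op^[k] g) := by
  have hlim : Tendsto (fun ω : ℕ => ∫ s in Set.Icc 0 T, Real.exp (-(ω : ℝ) * s) * ν.D s ∂ν.base) atTop
      (𝓝 (∫ s in Set.Icc 0 T, (0 : ℝ) ∂ν.base)) := by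
    refine tendsto_integral_filter_of_dominated_convergence ν.D ?_ ?_ (ν.D_int T) ?_
    · refine Eventually.of_forall fun ω => ?_
      have h1 : Measurable fun s : ℝ => Real.exp (-(ω : ℝ) * s) := by fun_prop
      exact (h1.mul ν.D_meas).aestronglyMeasurable
    · refine Eventually.of_forall fun ω => ?_
      filter_upwards [ae_restrict_mem measurableSet_Icc] with s hs
      rw [Real.norm_of_nonneg (mul_nonneg (Real.exp_pos _).le (ν.D_nonneg s))]
      refine mul_le_of_le_one_left (ν.D_nonneg s) ?_
      rw [Real.exp_le_one_iff]
      have : 0 ≤ (ω : ℝ) * s := mul_nonneg (Nat.cast_nonneg ω) hs.1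
      linarith
    · filter_upwards [ae_restrict_mem measurableSet_Icc] with s hs
      rcases hs.1.eq_or_lt with h | h
      · rw [← h, h0]; simp
      · have h1 : Tendsto (fun ω : ℕ => (ω : ℝ) * s) atTop atTop :=
          tendsto_natCast_atTop_atTop.atTop_mul_const h
        have h2 := (Real.tendsto_exp_neg_atTop_nhds_zero.comp h1).mul_const (ν.D s)
        simpa [Function.comp_def] using h2
  rw [integral_zero] at hlim
  obtain ⟨ω, hω⟩ := (hlim.eventually (gt_mem_nhds (show (0 : ℝ) < 1 / 2 by norm_num))).exists
  refine ⟨Real.exp (ω * T), (Real.exp_pos _).le, fun C g k hg => ?_⟩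
  have key : ∀ k, Measurable (ν.op^[k] g) ∧ ∀ t, ‖ν.op^[k] g t‖ ≤ (Set.Icc 0 T).indicator
      (fun t => (Real.exp (ω * T) * (1 / 2) ^ k * C) * Real.exp (-(ω : ℝ) * t)) t := by
    intro k
    induction k with
    | zero =>
      refine ⟨hg.2.1, fun t => ?_⟩
      have := hg.2.2 t
      by_cases ht : t ∈ Set.Icc 0 T
      · rw [Set.indicator_of_mem ht] at this ⊢
        refine this.trans ?_
        have h1 : 1 ≤ Real.exp (ω * T) * Real.exp (-(ω : ℝ) * t) := by
          rw [← Real.exp_add, Real.one_le_exp_iff]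
          have : (ω : ℝ) * t ≤ ω * T := mul_le_mul_of_nonneg_left ht.2 (Nat.cast_nonneg ω)
          linarith
        calc C = 1 * C := by ring
          _ ≤ (Real.exp (ω * T) * Real.exp (-(ω : ℝ) * t)) * C := mul_le_mul_of_nonneg_right h1 hg.1
          _ = _ := by ring
      · rw [Set.indicator_of_notMem ht] at this ⊢
        exact this
    | succ k ih =>
      rw [Function.iterate_succ_apply']
      refine ⟨ν.op_meas ih.1, fun t => ?_⟩
      have hC : 0 ≤ Real.exp (ω * T) * (1 / 2) ^ k * C := mul_nonneg (by positivity) hg.1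
      refine (ν.op_bound hC (fun t _ => ih.2 t) t).trans ?_
      refine Set.indicator_le_indicator ?_
      calc _ ≤ (1 / 2) * (Real.exp (ω * T) * (1 / 2) ^ k * C) * Real.exp (-(ω : ℝ) * t) := by
            gcongr
        _ = _ := by ring
  have hC : 0 ≤ Real.exp (ω * T) * (1 / 2) ^ k * C := mul_nonneg (by positivity) hg.1
  refine ⟨hC, (key k).1, fun t => ((key k).2 t).trans ?_⟩
  by_cases ht : t ∈ Set.Icc 0 T
  · rw [Set.indicator_of_mem ht, Set.indicator_of_mem ht]
    refine mul_le_of_le_one_right hC ?_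
    rw [Real.exp_le_one_iff]
    have : 0 ≤ (ω : ℝ) * t := mul_nonneg (Nat.cast_nonneg ω) ht.1
    linarith
  · rw [Set.indicator_of_notMem ht, Set.indicator_of_notMem ht]

theorem IsOp.iterate {N : (ℝ → Fin n → ℂ) → (ℝ → Fin n → ℂ)} (h : IsOp N) (k : ℕ) :
    IsOp (fun g => N^[k] g) := by
  induction k with
  | zero => exact IsOp.id
  | succ k ih =>
    simp only [Function.iterate_succ_apply']
    exact h.comp ih

/-- Neumann series. -/
noncomputable def neumann (N : (ℝ → Fin n → ℂ) → (ℝ → Fin n → ℂ)) (g : ℝ → Fin n → ℂ) :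
    ℝ → Fin n → ℂ := fun t => ∑' k, N^[k] g t

theorem geom_hasSum (K C : ℝ) : HasSum (fun k : ℕ => K * (1 / 2) ^ k * C) (K * 2 * C) :=
  (hasSum_geometric_two.mul_left K).mul_right C

theorem neumann_hasSum {N : (ℝ → Fin n → ℂ) → (ℝ → Fin n → ℂ)}
    (hdec : ∀ T, ∃ K : ℝ, 0 ≤ K ∧ ∀ C g k, Dom C T g → Dom (K * (1 / 2) ^ k * C) T (N^[k] g))
    {C T : ℝ} {g : ℝ → Fin n → ℂ} (hg : Dom C T g) (t : ℝ) :
    HasSum (fun k => N^[k] g t) (neumann N g t) := by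
  obtain ⟨K, hK, hd⟩ := hdec T
  exact (Summable.of_norm_bounded (geom_hasSum K C).summable fun k => (hd C g k hg).le t).hasSum

theorem neumann_dom {N : (ℝ → Fin n → ℂ) → (ℝ → Fin n → ℂ)}
    (hdec : ∀ T, ∃ K : ℝ, 0 ≤ K ∧ ∀ C g k, Dom C T g → Dom (K * (1 / 2) ^ k * C) T (N^[k] g))
    (T : ℝ) : ∃ K : ℝ, 0 ≤ K ∧ ∀ C g, Dom C T g → Dom (K * C) T (neumann N g) ∧
    ∀ m, Dom (K * C) T (∑ k ∈ Finset.range m, N^[k] g) := by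
  obtain ⟨K, hK, hd⟩ := hdec T
  refine ⟨K * 2, by positivity, fun C g hg => ⟨?_, ?_⟩⟩
  · refine Dom.mk' (mul_nonneg (by positivity) hg.1) ?_ ?_ ?_ ?_
    · refine measurable_of_tendsto_metrizable (f := fun m => ∑ k ∈ Finset.range m, N^[k] g)
        (fun m => ?_) ?_
      · exact (Dom.sum (Finset.range m) fun k _ => hd C g k hg).2.1
      · rw [tendsto_pi_nhds]
        intro t
        simpa only [Finset.sum_apply] using (neumann_hasSum hdec hg t).tendsto_sum_nat
    · intro t ht
      unfold neumann
      simp only [fun k => (hd C g k hg).zero_of_neg ht, tsum_zero]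
    · intro t ht
      unfold neumann
      simp only [fun k => (hd C g k hg).zero_of_gt ht, tsum_zero]
    · intro t
      exact tsum_of_norm_bounded (geom_hasSum K C) fun k => (hd C g k hg).le t
  · intro m
    refine (Dom.sum (Finset.range m) fun k _ => hd C g k hg).mono ?_ le_rfl
    exact sum_le_hasSum _ (fun k _ => (hd C g k hg).1) (geom_hasSum K C)

theorem neumann_isOp {N : (ℝ → Fin n → ℂ) → (ℝ → Fin n → ℂ)} (h : IsOp N)
    (hdec : ∀ T, ∃ K : ℝ, 0 ≤ K ∧ ∀ C g k, Dom C T g → Dom (K * (1 / 2) ^ k * C) T (N^[k] g))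
    : IsOp (neumann N) where
  dom T := by
    obtain ⟨K, hK, hd⟩ := neumann_dom hdec T
    exact ⟨K, hK, fun C g hg => (hd C g hg).1⟩
  add C T C' T' g g' hg hg' := by
    funext t
    refine HasSum.unique (neumann_hasSum hdec (hg.add hg') t) ?_
    have := (neumann_hasSum hdec hg t).add (neumann_hasSum hdec hg' t)
    refine this.congr_fun fun k => ?_
    rw [(h.iterate k).add _ _ _ _ _ _ hg hg']
    rfl
  smul C T g c hg := by
    funext t
    refine HasSum.unique (neumann_hasSum hdec (hg.smul c) t) ?_
    have := (neumann_hasSum hdec hg t).const_smul c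
    refine this.congr_fun fun k => ?_
    rw [(h.iterate k).smul _ _ _ _ hg]
    rfl
  cont l _ C T G g hG hg hl t := by
    obtain ⟨K, hK, hd⟩ := hdec T
    exact tendsto_tsum_of_dominated_convergence (geom_hasSum K C).summable
      (fun k => (h.iterate k).cont l C T G g hG hg hl t)
      (Eventually.of_forall fun m k => (hd C _ k (hG m)).le t)
  shift C T g a hg ha := by
    funext t
    refine HasSum.unique (neumann_hasSum hdec (hg.shift ha) t) ?_
    by_cases ht : 0 ≤ t
    · simp only [LocalMatrixMeasure.shift, ht, if_true]
      refine (neumann_hasSum hdec hg (t + a)).congr_fun fun k => ?_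
      have := congrFun ((h.iterate k).shift _ _ _ _ hg ha) t
      simp only [LocalMatrixMeasure.shift, ht, if_true] at this
      exact this
    · simp only [LocalMatrixMeasure.shift, ht, if_false]
      refine hasSum_zero.congr_fun fun k => ?_
      have := congrFun ((h.iterate k).shift _ _ _ _ hg ha) t
      simp only [LocalMatrixMeasure.shift, ht, if_false] at this
      exact this

theorem neumann_right {N : (ℝ → Fin n → ℂ) → (ℝ → Fin n → ℂ)} (h : IsOp N)
    (hdec : ∀ T, ∃ K : ℝ, 0 ≤ K ∧ ∀ C g k, Dom C T g → Dom (K * (1 / 2) ^ k * C) T (N^[k] g))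
    {C T : ℝ} {g : ℝ → Fin n → ℂ} (hg : Dom C T g) :
    neumann N g = g + neumann N (N g) := by
  obtain ⟨K, hK, hd⟩ := h.dom T
  funext t
  have h1 := (neumann_hasSum hdec hg t).summable.tsum_eq_zero_add
  exact h1

theorem neumann_left {N : (ℝ → Fin n → ℂ) → (ℝ → Fin n → ℂ)} (h : IsOp N)
    (hdec : ∀ T, ∃ K : ℝ, 0 ≤ K ∧ ∀ C g k, Dom C T g → Dom (K * (1 / 2) ^ k * C) T (N^[k] g))
    {C T : ℝ} {g : ℝ → Fin n → ℂ} (hg : Dom C T g) :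
    neumann N g = g + N (neumann N g) := by
  obtain ⟨K, hK, hd⟩ := neumann_dom hdec T
  obtain ⟨K', hK', hd'⟩ := hdec T
  obtain ⟨K1, hK1, hd1⟩ := h.dom T
  rw [neumann_right h hdec hg]
  congr 1
  rw [← neumann_right h hdec hg]
  funext t
  have hlim : ∀ t, Tendsto (fun m => (∑ k ∈ Finset.range m, N^[k] g) t) atTop
      (𝓝 (neumann N g t)) := fun t => by
    simpa only [Finset.sum_apply] using (neumann_hasSum hdec hg t).tendsto_sum_nat
  have h1 := h.cont atTop _ _ _ _ (hd C g hg).2 (hd C g hg).1 hlim t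
  have h2 := (neumann_hasSum hdec (hd1 _ _ hg) t).tendsto_sum_nat
  refine tendsto_nhds_unique h2 (h1.congr fun m => ?_)
  rw [h.sum _ fun k _ => hd' C g k hg, Finset.sum_apply]
  refine Finset.sum_congr rfl fun k _ => ?_
  rw [← Function.iterate_succ_apply' N, Function.iterate_succ_apply]

theorem exists_resolvent (μ : LocalMatrixMeasure n)
    (hdet : Matrix.det ((1 : Matrix (Fin n) (Fin n) ℂ) - μ.val {0}) ≠ 0) :
    ∃ ρ : LocalMatrixMeasure n, IsResolvent μ ρ := by
  have hu : IsUnit (Matrix.det ((1 : Matrix (Fin n) (Fin n) ℂ) - μ.val {0})) := hdet.isUnit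
  let A := μ.val {0}
  let B := (1 - A)⁻¹
  have hAB : (1 - A) * B = 1 := Matrix.mul_nonsing_inv _ hu
  have hBA : B * (1 - A) = 1 := Matrix.nonsing_inv_mul _ hu
  let ν := lmul B μ.pos
  have hν0 : ν.D 0 = 0 := by simp [D, ν, lmul, pos]
  have hN := ν.op_isOp
  have hdec := decay ν hν0
  have hS := neumann_isOp hN hdec
  have hB := (diracM B).op_isOp
  let Φ : (ℝ → Fin n → ℂ) → (ℝ → Fin n → ℂ) := fun g => neumann ν.op ((diracM B).op g) - g
  have hΦ : IsOp Φ := (hS.comp hB).subOp IsOp.id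
  obtain ⟨ρ, hρ⟩ := hΦ.exists_measure
  have hop : ∀ C T g, Dom C T g → ρ.op g = Φ g := fun C T g hg =>
    ρ.op_isOp.ext hΦ (fun E T j hE hET => by
      ext i
      rw [op_ind_zero _ hE, hρ E T hE hET]) hg
  have hBM : ∀ C T g, Dom C T g → (diracM B).op (μ.op g) = (diracM B).op g - g + ν.op g := by
    intro C T g hg
    obtain ⟨K, hK, hd⟩ := μ.pos.op_isOp.dom T
    obtain ⟨K', hK', hd'⟩ := (diracM A).op_isOp.dom T
    have h1 : ν.op g = (diracM B).op (μ.pos.op g) := lmul_op B μ.pos hg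
    rw [op_eq_pos μ hg, hB.add _ _ _ _ _ _ (hd' _ _ hg) (hd _ _ hg), h1]
    congr 1
    rw [diracM_op B (hd' _ _ hg), diracM_op A hg, diracM_op B hg]
    funext t
    simp only [Matrix.mulVec_mulVec, Pi.sub_apply]
    have : B * A = B - 1 := by rw [← hBA, mul_sub, mul_one]; abel
    rw [this, Matrix.sub_mulVec, Matrix.one_mulVec]
  refine ⟨ρ, (isResolvent_iff μ ρ).2 fun C T g hg => ?_⟩
  obtain ⟨K, hK, hd⟩ := μ.op_isOp.dom T
  obtain ⟨K1, hK1, hd1⟩ := hB.dom T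
  obtain ⟨K2, hK2, hd2⟩ := hS.dom T
  obtain ⟨K3, hK3, hd3⟩ := hN.dom T
  have hBg := hd1 _ _ hg
  have hH := hd2 _ _ hBg
  constructor
  · rw [hop _ _ _ hg]
    change neumann ν.op ((diracM B).op g) - g - μ.op (neumann ν.op ((diracM B).op g) - g) = μ.op g
    rw [μ.op_isOp.sub hH hg]
    have e1 := neumann_left hN hdec hBg
    set H := neumann ν.op ((diracM B).op g) with hHdef
    have e2 := hBM _ _ _ hH
    have e3 : (diracM B).op (μ.op H) = (diracM B).op (H - g) := by
      rw [e2, hB.sub hH hg]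
      have : ν.op H = H - (diracM B).op g := by
        rw [eq_sub_iff_add_eq, add_comm]; exact e1.symm
      rw [this]; abel
    have e4 : μ.op H = H - g := by
      rw [diracM_op B (hd _ _ hH), diracM_op B (hH.sub hg)] at e3
      funext t
      have e5 := congrArg (fun v => (1 - A).mulVec v) (congrFun e3 t)
      simpa only [Matrix.mulVec_mulVec, hAB, Matrix.one_mulVec] using e5
    rw [e4]; abel
  · rw [hop _ _ _ hg, hop _ _ _ (hd _ _ hg)]
    change neumann ν.op ((diracM B).op g) - g -
      (neumann ν.op ((diracM B).op (μ.op g)) - μ.op g) = μ.op g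
    rw [hBM _ _ _ hg, hS.add _ _ _ _ _ _ (hBg.sub hg) (hd3 _ _ hg), hS.sub hBg hg]
    have e1 := neumann_right hN hdec hg
    have e2 : neumann ν.op (ν.op g) = neumann ν.op g - g := by
      rw [eq_sub_iff_add_eq, add_comm]; exact e1.symm
    rw [e2]; abel

end LocalMatrixMeasure

/-- Theorem A.12 (half of \cite[Thm 4.1.5]{GLS90}) of Diekmann–Verduyn Lunel: a
`ℂ^{n×n}`-valued local Borel measure `μ` on `[0,∞)` admits a resolvent `ρ` (satisfying
`ρ − μ ∗ ρ = μ = ρ − ρ ∗ μ`) if and only if `det[I − μ({0})] ≠ 0`; when it exists, the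
resolvent is unique (as a set function on bounded Borel sets). -/
theorem resolvent_exists_iff_and_unique {n : ℕ} (μ : LocalMatrixMeasure n) :
    ((∃ ρ : LocalMatrixMeasure n, LocalMatrixMeasure.IsResolvent μ ρ)
      ↔ Matrix.det ((1 : Matrix (Fin n) (Fin n) ℂ) - μ.val {0}) ≠ 0)
    ∧ (∀ ρ₁ ρ₂ : LocalMatrixMeasure n,
        LocalMatrixMeasure.IsResolvent μ ρ₁ → LocalMatrixMeasure.IsResolvent μ ρ₂ →
        ∀ E : Set ℝ, MeasurableSet E → Bornology.IsBounded E → ρ₁.val E = ρ₂.val E) := by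
  refine ⟨⟨fun ⟨ρ, hρ⟩ => LocalMatrixMeasure.det_ne_zero_of_resolvent μ ρ hρ,
    fun h => LocalMatrixMeasure.exists_resolvent μ h⟩, fun ρ₁ ρ₂ h₁ h₂ E hE hb =>
    LocalMatrixMeasure.resolvent_unique μ ρ₁ ρ₂ h₁ h₂ E hE hb⟩
end
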